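/- arXiv:2409.18514 — 3 statements merged into one kernel-verified Lean document; each statement's English description precedes it below -/
import Mathlib

section
/- Let ℋ = ℋ₁ ⊗ ℋ₂ with dim ℋ₁ ≥ 2, dim ℋ₂ ≥ 2, and let 𝓔₂ : B(ℋ₂) → B(ℋ₂) be a quantum channel. Bath dynamical decoupling with 𝓔 = 𝓘₁ ⊗ 𝓔₂ works — i.e. for every Hermitian H ∈ B(ℋ) with operator Schmidt decomposition H = H₁⊗𝟙₂ + 𝟙₁⊗H₂ + Σ_i h₁^(i)⊗h₂^(i) (all of H₁, H₂, h₁^(i), h₂^(i) traceless), the Zeno Hamiltonian 𝓗_Z^𝓔 = Σ_{|λ_ℓ|=1} (𝓘₁⊗P_ℓ)[H,·](𝓘₁⊗P_ℓ) satisfies 𝓗_Z^𝓔 = ([H₁ + Σ_i c_i h₁^(i), ·] ⊗ 𝓘₂) ∘ (𝓘₁⊗P_φ) for some real constants c_i — if and only if 𝓔₂ is ergodic. In that case the constants are c_i = tr(h₂^(i) ρ*), where ρ* is the unique fixed-point state of 𝓔₂. -/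
open Matrix Kronecker
open scoped ComplexOrder
noncomputable section

abbrev MatC (n : ℕ) := Matrix (Fin n) (Fin n) ℂ

/-- The Choi-Jamiołkowski matrix of a linear map on matrices. -/
def choi {n : ℕ} (E : MatC n →ₗ[ℂ] MatC n) : Matrix (Fin n × Fin n) (Fin n × Fin n) ℂ :=
  fun p q => E (Matrix.single p.2 q.2 1) p.1 q.1

/-- A quantum channel: a completely positive (equivalently, with positive semidefinite
Choi matrix) and trace-preserving linear map. -/
def IsQuantumChannel {n : ℕ} (E : MatC n →ₗ[ℂ] MatC n) : Prop :=
  (choi E).PosSemidef ∧ ∀ A : MatC n, (E A).trace = A.trace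

/-- A channel is ergodic when its fixed-point space is one-dimensional. -/
def IsErgodic {n : ℕ} (E : MatC n →ₗ[ℂ] MatC n) : Prop :=
  Module.finrank ℂ (Module.End.eigenspace E 1) = 1


abbrev MatC2 (d₁ d₂ : ℕ) := Matrix (Fin d₁ × Fin d₂) (Fin d₁ × Fin d₂) ℂ

/-- `P` is the spectral projection of `E` associated with the eigenvalue `μ`: the projection
onto the generalized eigenspace of `μ` along the sum of all other generalized eigenspaces. -/
def IsSpectralProjection {n : ℕ} (E P : MatC n →ₗ[ℂ] MatC n) (μ : ℂ) : Prop :=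
  P ∘ₗ P = P ∧
  LinearMap.range P = Module.End.maxGenEigenspace E μ ∧
  LinearMap.ker P = ⨆ ν ∈ {ν : ℂ | ν ≠ μ}, Module.End.maxGenEigenspace E ν

/-- The map `𝓘₁ ⊗ 𝓔` on operators of a bipartite system, acting as `𝓔` on the second factor. -/
def idTensor {d₁ d₂ : ℕ} (E : MatC d₂ →ₗ[ℂ] MatC d₂) : MatC2 d₁ d₂ →ₗ[ℂ] MatC2 d₁ d₂ where
  toFun M := Matrix.of fun p q => E (Matrix.of fun a b => M (p.1, a) (q.1, b)) p.2 q.2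
  map_add' M N := by
    ext p q
    have h : (Matrix.of fun a b => (M + N) (p.1, a) (q.1, b)) =
        (Matrix.of fun a b => M (p.1, a) (q.1, b)) +
          (Matrix.of fun a b => N (p.1, a) (q.1, b)) := rfl
    show E (Matrix.of fun a b => (M + N) (p.1, a) (q.1, b)) p.2 q.2 = _
    rw [h, map_add]
    rfl
  map_smul' c M := by
    ext p q
    have h : (Matrix.of fun a b => (c • M) (p.1, a) (q.1, b)) =
        c • (Matrix.of fun a b => M (p.1, a) (q.1, b)) := rfl
    show E (Matrix.of fun a b => (c • M) (p.1, a) (q.1, b)) p.2 q.2 = _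
    rw [h, _root_.map_smul]
    rfl


namespace BDD

/-- Kraus form of a channel. -/
def IsKraus {n : ℕ} {κ : Type} [Fintype κ] (E : MatC n →ₗ[ℂ] MatC n) (K : κ → MatC n) : Prop :=
  (∀ X, E X = ∑ i, K i * X * (K i)ᴴ) ∧ ∑ i, (K i)ᴴ * K i = 1

lemma exists_factor {m : Type} [Fintype m] [DecidableEq m] {A : Matrix m m ℂ}
    (hA : A.PosSemidef) : ∃ B : Matrix m m ℂ, A = Bᴴ * B := by
  open scoped MatrixOrder in
  exact CStarAlgebra.nonneg_iff_eq_star_mul_self.mp hA.nonneg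

lemma exists_kraus {n : ℕ} {E : MatC n →ₗ[ℂ] MatC n} (hE : IsQuantumChannel E) :
    ∃ K : (Fin n × Fin n) → MatC n, IsKraus E K := by
  obtain ⟨hC, hT⟩ := hE
  obtain ⟨B, hB⟩ := exists_factor hC
  have h1 : ∀ X, E X = ∑ m, (Matrix.of fun i k => star (B m (i,k)) : MatC n) * X *
      (Matrix.of fun i k => star (B m (i,k)) : MatC n)ᴴ := by
    intro X
    conv_lhs => rw [Matrix.matrix_eq_sum_single X]
    simp only [map_sum]
    ext i j
    have h2 : ∀ k l, E (Matrix.single k l (X k l)) i j = X k l * ∑ m, star (B m (i,k)) * B m (j,l) := by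
      intro k l
      have h3 : Matrix.single k l (X k l) = X k l • Matrix.single k l (1:ℂ) := by
        simp [Matrix.smul_single]
      rw [h3, _root_.map_smul, Matrix.smul_apply, smul_eq_mul]
      congr 1
      have := congrFun (congrFun hB (i,k)) (j,l)
      simpa [choi, Matrix.mul_apply] using this
    simp only [Matrix.sum_apply, h2, Matrix.mul_apply, Matrix.of_apply, Matrix.conjTranspose_apply,
      star_star, Finset.mul_sum, Finset.sum_mul]
    rw [Finset.sum_congr rfl (fun k _ => Finset.sum_comm), Finset.sum_comm]
    refine Finset.sum_congr rfl fun m _ => ?_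
    rw [Finset.sum_comm]
    refine Finset.sum_congr rfl fun l _ => Finset.sum_congr rfl fun k _ => by ring
  refine ⟨fun m => Matrix.of fun i k => star (B m (i,k)), h1, ?_⟩
  rw [Matrix.ext_iff_trace_mul_right]
  intro X
  rw [one_mul, ← hT X, h1 X, Finset.sum_mul, Matrix.trace_sum, Matrix.trace_sum]
  refine Finset.sum_congr rfl fun m _ => ?_
  rw [Matrix.mul_assoc, Matrix.trace_mul_comm]

variable {n : ℕ} {κ : Type} [Fintype κ] {E : MatC n →ₗ[ℂ] MatC n} {K : κ → MatC n}

lemma IsKraus.trace_E (h : IsKraus E K) (X : MatC n) : (E X).trace = X.trace := by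
  rw [h.1, Matrix.trace_sum]
  calc _ = ∑ i, ((K i)ᴴ * K i * X).trace := Finset.sum_congr rfl fun m _ => by
        rw [Matrix.mul_assoc ((K m)ᴴ), Matrix.trace_mul_comm ((K m)ᴴ)]
    _ = _ := by rw [← Matrix.trace_sum, ← Finset.sum_mul, h.2, one_mul]

/-- Domination of the sesquilinear form of `R` by that of `A`. -/
def Good (A R : MatC n) : Prop := ∀ x y : Fin n → ℂ,
  2 * ‖star x ⬝ᵥ R *ᵥ y‖ ≤ (star x ⬝ᵥ A *ᵥ x).re + (star y ⬝ᵥ A *ᵥ y).re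

lemma form_kraus (h : IsKraus E K) (X : MatC n) (x y : Fin n → ℂ) :
    star x ⬝ᵥ (E X) *ᵥ y = ∑ i, star ((K i)ᴴ *ᵥ x) ⬝ᵥ X *ᵥ ((K i)ᴴ *ᵥ y) := by
  rw [h.1, Matrix.sum_mulVec, dotProduct_sum]
  refine Finset.sum_congr rfl fun i _ => ?_
  rw [Matrix.star_mulVec, Matrix.conjTranspose_conjTranspose, ← Matrix.mulVec_mulVec,
    ← Matrix.mulVec_mulVec, Matrix.dotProduct_mulVec]

lemma Good.step (h : IsKraus E K) {A R : MatC n} (g : Good A R) : Good (E A) (E R) := by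
  intro x y
  rw [form_kraus h, form_kraus h, form_kraus h, Complex.re_sum, Complex.re_sum,
    ← Finset.sum_add_distrib]
  calc _ ≤ 2 * ∑ i, ‖star ((K i)ᴴ *ᵥ x) ⬝ᵥ R *ᵥ ((K i)ᴴ *ᵥ y)‖ := by
        gcongr; exact norm_sum_le _ _
    _ ≤ _ := by rw [Finset.mul_sum]; exact Finset.sum_le_sum fun i _ => g _ _

lemma Good.pow (h : IsKraus E K) {A R : MatC n} (g : Good A R) (k : ℕ) :
    Good ((E ^ k) A) ((E ^ k) R) := by
  induction k with
  | zero => simpa using g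
  | succ k ih => rw [pow_succ', Module.End.mul_apply, Module.End.mul_apply]; exact ih.step h

lemma Good.smul {A R : MatC n} (g : Good A R) {c : ℂ} (hc : ‖c‖ = 1) : Good A (c • R) := by
  intro x y
  have := g x y
  rwa [Matrix.smul_mulVec, dotProduct_smul, norm_smul, hc, one_mul]

lemma exists_good (R : MatC n) : ∃ t : ℝ, 0 ≤ t ∧ Good ((t : ℂ) • (1 : MatC n)) R := by
  refine ⟨∑ i, ∑ j, ‖R i j‖, by positivity, fun x y => ?_⟩
  have hq : ∀ z : Fin n → ℂ, (star z ⬝ᵥ z).re = ∑ i, ‖z i‖ ^ 2 := by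
    intro z
    simp only [dotProduct, Complex.re_sum, Pi.star_apply]
    refine Finset.sum_congr rfl fun i _ => ?_
    rw [← Complex.normSq_eq_norm_sq, Complex.star_def, ← Complex.normSq_eq_conj_mul_self]
    simp
  have hq2 : ∀ (t : ℝ) (z : Fin n → ℂ),
      (star z ⬝ᵥ ((t : ℂ) • (1 : MatC n)) *ᵥ z).re = t * ∑ i, ‖z i‖ ^ 2 := by
    intro t z
    rw [Matrix.smul_mulVec, Matrix.one_mulVec, dotProduct_smul, smul_eq_mul, Complex.re_ofReal_mul,
      hq]
  rw [hq2, hq2, ← mul_add]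
  have h1 : star x ⬝ᵥ R *ᵥ y = ∑ i, ∑ j, star (x i) * (R i j * y j) := by
    simp [dotProduct, Matrix.mulVec, Finset.mul_sum]
  have hle : ∀ (z : Fin n → ℂ) i, ‖z i‖ ^ 2 ≤ ∑ i, ‖z i‖ ^ 2 := fun z i =>
    Finset.single_le_sum (f := fun i => ‖z i‖ ^ 2) (fun _ _ => by positivity) (Finset.mem_univ i)
  rw [h1, Finset.sum_mul]
  calc _ ≤ 2 * ∑ i, ∑ j, ‖star (x i) * (R i j * y j)‖ := by
        gcongr
        exact (norm_sum_le _ _).trans (Finset.sum_le_sum fun i _ => norm_sum_le _ _)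
    _ ≤ _ := by
        rw [Finset.mul_sum]
        refine Finset.sum_le_sum fun i _ => ?_
        rw [Finset.mul_sum, Finset.sum_mul]
        refine Finset.sum_le_sum fun j _ => ?_
        rw [norm_mul, norm_mul, norm_star]
        have h2 := hle x i
        have h3 := hle y j
        have h4 : 2 * (‖x i‖ * ‖y j‖) ≤ ∑ i, ‖x i‖ ^ 2 + ∑ i, ‖y i‖ ^ 2 := by
          nlinarith [sq_nonneg (‖x i‖ - ‖y j‖)]
        nlinarith [norm_nonneg (R i j)]

lemma form_single (A : MatC n) (i j : Fin n) :
    star (Pi.single i (1:ℂ)) ⬝ᵥ A *ᵥ (Pi.single j 1) = A i j := by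
  rw [← Pi.single_star]; simp

lemma Good.nonneg {A R : MatC n} (g : Good A R) (x : Fin n → ℂ) : 0 ≤ (star x ⬝ᵥ A *ᵥ x).re := by
  have := g x x
  have := norm_nonneg (star x ⬝ᵥ R *ᵥ x)
  linarith

lemma Good.entry {A R : MatC n} (g : Good A R) (i j : Fin n) : ‖R i j‖ ≤ A.trace.re := by
  have h := g (Pi.single i 1) (Pi.single j 1)
  rw [form_single, form_single, form_single] at h
  have hn : ∀ k, 0 ≤ (A k k).re := fun k => by
    have := g.nonneg (Pi.single k 1); rwa [form_single] at this
  have hs : ∀ k, (A k k).re ≤ A.trace.re := fun k => by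
    rw [Matrix.trace, Complex.re_sum]
    exact Finset.single_le_sum (f := fun k => (A.diag k).re) (fun k _ => hn k) (Finset.mem_univ k)
  have := hs i; have := hs j
  linarith

lemma good_one : Good (1 : MatC n) 1 := by
  intro x y
  simp only [Matrix.one_mulVec]
  have h1 : (star x ⬝ᵥ x).re + (star y ⬝ᵥ y).re = ∑ i, (‖x i‖ ^ 2 + ‖y i‖ ^ 2) := by
    rw [Finset.sum_add_distrib]
    congr 1 <;>
    · simp only [dotProduct, Complex.re_sum, Pi.star_apply]
      refine Finset.sum_congr rfl fun i _ => ?_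
      rw [← Complex.normSq_eq_norm_sq, Complex.star_def, ← Complex.normSq_eq_conj_mul_self]
      simp
  rw [h1]
  calc _ ≤ 2 * ∑ i, ‖star (x i) * y i‖ := by
        gcongr; exact norm_sum_le _ _
    _ ≤ _ := by
        rw [Finset.mul_sum]
        refine Finset.sum_le_sum fun i _ => ?_
        rw [norm_mul, norm_star]
        nlinarith [sq_nonneg (‖x i‖ - ‖y i‖)]

lemma IsKraus.trace_pow (h : IsKraus E K) (X : MatC n) (k : ℕ) : ((E ^ k) X).trace = X.trace := by
  induction k with
  | zero => simp
  | succ k ih => rw [pow_succ', Module.End.mul_apply, h.trace_E, ih]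

/-- power-boundedness -/
lemma power_bounded (h : IsKraus E K) (X : MatC n) :
    ∃ C : ℝ, ∀ k i j, ‖((E ^ k) X) i j‖ ≤ C := by
  obtain ⟨t, ht, g⟩ := exists_good X
  refine ⟨(Matrix.trace ((t : ℂ) • (1 : MatC n))).re, fun k i j => ?_⟩
  rw [← h.trace_pow _ k]
  exact (g.pow h k).entry i j

lemma semisimple_two (h : IsKraus E K) {μ : ℂ} (hμ : ‖μ‖ = 1) (u : MatC n)
    (hu : E (E u - μ • u) = μ • (E u - μ • u)) : E u = μ • u := by
  set w := E u - μ • u with hw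
  have key : ∀ k : ℕ, μ • (E ^ k) u = μ ^ k • (μ • u + (k : ℂ) • w) := by
    intro k
    induction k with
    | zero => simp
    | succ k ih =>
      rw [pow_succ', Module.End.mul_apply, ← _root_.map_smul, ih, _root_.map_smul, map_add,
        _root_.map_smul, _root_.map_smul, hu]
      have : E u = μ • u + w := by rw [hw]; abel
      rw [this]
      push_cast
      module
  obtain ⟨C, hC⟩ := power_bounded h u
  have hw0 : w = 0 := by
    ext i j
    by_contra hne
    have hpos : 0 < ‖w i j‖ := norm_pos_iff.mpr hne
    obtain ⟨k, hk⟩ := exists_nat_gt ((C + ‖u i j‖) / ‖w i j‖)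
    rw [div_lt_iff₀ hpos] at hk
    have h1 := congrArg norm (congrFun (congrFun (key k) i) j)
    simp only [Matrix.smul_apply, Matrix.add_apply, norm_smul, norm_pow, hμ, one_pow, one_mul] at h1
    have h2 := hC k i j
    have h3 : ‖(k : ℂ) • w i j‖ ≤ ‖μ • u i j + (k : ℂ) • w i j‖ + ‖μ • u i j‖ := by
      have := norm_sub_le (μ • u i j + (k : ℂ) • w i j) (μ • u i j)
      simpa using this
    simp only [norm_smul, hμ, one_mul, Complex.norm_natCast] at h3
    rw [← h1] at h3
    linarith
  exact sub_eq_zero.mp hw0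

lemma maxGen_eq (h : IsKraus E K) {μ : ℂ} (hμ : ‖μ‖ = 1) {u : MatC n}
    (hu : u ∈ Module.End.maxGenEigenspace E μ) : E u = μ • u := by
  rw [Module.End.mem_maxGenEigenspace] at hu
  obtain ⟨k, hk⟩ := hu
  have : ∀ k : ℕ, ((E - μ • (1 : Module.End ℂ (MatC n))) ^ k) u = 0 → E u = μ • u := by
    intro k
    induction k with
    | zero => intro hk; have : u = 0 := by simpa using hk
              simp [this]
    | succ k ih =>
      intro hk
      rcases k with _ | k
      · simpa [sub_eq_zero] using hk
      · apply ih
        rw [pow_succ', Module.End.mul_apply, pow_succ', Module.End.mul_apply] at hk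
        rw [pow_succ', Module.End.mul_apply]
        set v := ((E - μ • (1 : Module.End ℂ (MatC n))) ^ k) u
        have := semisimple_two h hμ v (by simpa [sub_eq_zero] using hk)
        simpa [sub_eq_zero] using this
  exact this k hk

open Filter Topology in
lemma Good.limit {A R : ℕ → MatC n} {A' R' : MatC n} (g : ∀ k, Good (A k) (R k))
    (hA : Tendsto A atTop (𝓝 A')) (hR : Tendsto R atTop (𝓝 R')) : Good A' R' := by
  intro x y
  have hc : ∀ x y : Fin n → ℂ, Continuous fun A : MatC n => star x ⬝ᵥ A *ᵥ y := fun x y =>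
    continuous_const.dotProduct (continuous_id.matrix_mulVec continuous_const)
  have h1 := (((hc x y).norm.tendsto R').comp hR).const_mul 2
  have h2 := (((Complex.continuous_re.comp (hc x x)).tendsto A').comp hA).add
    (((Complex.continuous_re.comp (hc y y)).tendsto A').comp hA)
  exact le_of_tendsto_of_tendsto' h1 h2 fun k => g k x y

/-- Averages. -/
def avg (A : ℕ → MatC n) (m : ℕ) : MatC n :=
  (((m + 1 : ℝ)⁻¹ : ℝ) : ℂ) • ∑ k ∈ Finset.range (m + 1), A k

lemma Good.avg {A R : ℕ → MatC n} (g : ∀ k, Good (A k) (R k)) (m : ℕ) :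
    Good (avg A m) (avg R m) := by
  intro x y
  have hf : ∀ (A : ℕ → MatC n) (x y : Fin n → ℂ), star x ⬝ᵥ (BDD.avg A m) *ᵥ y =
      (((m + 1 : ℝ)⁻¹ : ℝ) : ℂ) * ∑ k ∈ Finset.range (m + 1), star x ⬝ᵥ A k *ᵥ y := by
    intro A x y
    rw [BDD.avg, Matrix.smul_mulVec, Matrix.sum_mulVec, dotProduct_smul, dotProduct_sum, smul_eq_mul]
  rw [hf, hf, hf, Complex.re_ofReal_mul, Complex.re_ofReal_mul, norm_mul, Complex.norm_real,
    Real.norm_of_nonneg (by positivity), ← mul_add, Complex.re_sum, Complex.re_sum,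
    ← Finset.sum_add_distrib, mul_left_comm]
  gcongr
  calc _ ≤ 2 * ∑ k ∈ Finset.range (m + 1), ‖star x ⬝ᵥ R k *ᵥ y‖ := by
        gcongr; exact norm_sum_le _ _
    _ ≤ _ := by rw [Finset.mul_sum]; exact Finset.sum_le_sum fun i _ => g _ _ _

lemma avg_const (R : MatC n) (m : ℕ) : avg (fun _ => R) m = R := by
  have h : ((m : ℂ) + 1) ≠ 0 := by exact_mod_cast Nat.succ_ne_zero m
  rw [avg, Finset.sum_const, Finset.card_range, ← Nat.cast_smul_eq_nsmul ℂ, smul_smul]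
  push_cast
  rw [inv_mul_cancel₀ h, one_smul]

open Filter Topology in
lemma exists_invariant (h : IsKraus E K) :
    ∃ A : MatC n, A.PosSemidef ∧ E A = A ∧ A.trace = n ∧
      ∀ μ : ℂ, ‖μ‖ = 1 → ∀ R, E R = μ • R → ∃ t : ℝ, Good ((t : ℂ) • A) R := by
  set C : ℕ → MatC n := avg (fun k => (E ^ k) 1) with hC
  have gC : ∀ m, Good (C m) (C m) := fun m => Good.avg (fun k => good_one.pow h k) m
  have tC : ∀ m, (C m).trace = n := by
    intro m
    have hm : ((m : ℂ) + 1) ≠ 0 := by exact_mod_cast Nat.succ_ne_zero m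
    simp only [hC, avg, Matrix.trace_smul, Matrix.trace_sum, h.trace_pow, Matrix.trace_one,
      Finset.sum_const, Finset.card_range, Fintype.card_fin, smul_eq_mul, nsmul_eq_mul]
    push_cast
    field_simp
  have hermE : ∀ X : MatC n, Xᴴ = X → (E X)ᴴ = E X := by
    intro X hX
    rw [h.1, Matrix.conjTranspose_sum]
    refine Finset.sum_congr rfl fun i _ => ?_
    simp [Matrix.conjTranspose_mul, hX, Matrix.mul_assoc]
  have hermP : ∀ k : ℕ, ((E ^ k) 1)ᴴ = (E ^ k) 1 := by
    intro k
    induction k with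
    | zero => simp
    | succ k ih => rw [pow_succ', Module.End.mul_apply]; exact hermE _ ih
  have hermC : ∀ m, (C m)ᴴ = C m := by
    intro m
    rw [hC, avg, Matrix.conjTranspose_smul, Matrix.conjTranspose_sum]
    simp only [hermP]
    simp
  have hcpt : IsCompact {f : Fin n → Fin n → ℂ | ∀ i, f i ∈ {g : Fin n → ℂ | ∀ j, g j ∈
      Metric.closedBall (0 : ℂ) n}} :=
    isCompact_pi_infinite fun i => isCompact_pi_infinite fun j => isCompact_closedBall _ _
  obtain ⟨A, -, φ, hφ, hlim⟩ := hcpt.tendsto_subseq (X := Fin n → Fin n → ℂ)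
    (x := fun m i j => C m i j)
    (fun m i j => by
      have := (gC m).entry i j
      rw [tC] at this
      simpa using this)
  have hlim' : Tendsto (fun m => C (φ m)) atTop (𝓝 (A : MatC n)) := hlim
  clear hlim
  have gA : Good (A : MatC n) A := Good.limit (fun k => gC (φ k)) hlim' hlim'
  have hermA : (A : MatC n)ᴴ = A := by
    have h1 : Tendsto (fun m => (C (φ m))ᴴ) atTop (𝓝 (A : MatC n)ᴴ) :=
      ((continuous_id.matrix_conjTranspose).tendsto _).comp hlim'
    simp only [hermC] at h1
    exact tendsto_nhds_unique h1 hlim'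
  have hEc : Continuous E := LinearMap.continuous_of_finiteDimensional E
  have hdiff : ∀ m, E (C m) - C m = (((m + 1 : ℝ)⁻¹ : ℝ) : ℂ) • ((E ^ (m + 1)) 1 - 1) := by
    intro m
    rw [hC, avg, _root_.map_smul, map_sum, ← smul_sub]
    congr 1
    have : ∀ k, E ((E ^ k) 1) = (E ^ (k + 1)) 1 := fun k => by
      rw [pow_succ', Module.End.mul_apply]
    simp only [this]
    rw [← Finset.sum_sub_distrib, Finset.sum_range_sub (fun k => (E ^ k) (1 : MatC n))]
    simp
  obtain ⟨c, hc⟩ := power_bounded h 1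
  have hd0 : Tendsto (fun m => E (C m) - C m) atTop (𝓝 0) := by
    refine tendsto_pi_nhds.mpr fun i => tendsto_pi_nhds.mpr fun j => ?_
    have hb : ∀ m : ℕ, ‖(E (C m) - C m) i j‖ ≤ (1 / ((m : ℝ) + 1)) * (2 * c) := by
      intro m
      rw [hdiff, Matrix.smul_apply, norm_smul, Complex.norm_real,
        Real.norm_of_nonneg (by positivity), one_div]
      gcongr
      have h1 := hc (m + 1) i j
      have h2 := hc 0 i j
      have h3 := norm_sub_le (((E ^ (m + 1)) (1 : MatC n)) i j) ((1 : MatC n) i j)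
      simp only [pow_zero, Module.End.one_apply] at h2
      rw [Matrix.sub_apply]
      linarith
    refine squeeze_zero_norm hb ?_
    simpa using (tendsto_one_div_add_atTop_nhds_zero_nat (𝕜 := ℝ)).mul_const (2 * c)
  have hfix : E (A : MatC n) = A := by
    have h1 := ((hEc.tendsto _).comp hlim').sub hlim'
    have h2 := hd0.comp hφ.tendsto_atTop
    exact sub_eq_zero.mp (tendsto_nhds_unique h1 h2)
  refine ⟨A, ?_, hfix, ?_, ?_⟩
  · refine .of_dotProduct_mulVec_nonneg hermA fun x => ?_
    rw [Complex.nonneg_iff]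
    exact ⟨gA.nonneg x, (Matrix.IsHermitian.im_star_dotProduct_mulVec_self hermA x).symm⟩
  · have h1 := ((continuous_id.matrix_trace).tendsto (A : MatC n)).comp hlim'
    have h2 : Tendsto (fun m => (C (φ m)).trace) atTop (𝓝 (n : ℂ)) := by
      simp only [tC]; exact tendsto_const_nhds
    exact tendsto_nhds_unique h1 h2
  · intro μ hμ R hR
    obtain ⟨t, ht, g⟩ := exists_good R
    refine ⟨t, ?_⟩
    have hμ0 : μ ≠ 0 := fun h => by simp [h] at hμ
    have hpow : ∀ k : ℕ, (E ^ k) R = μ ^ k • R := by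
      intro k
      induction k with
      | zero => simp
      | succ k ih =>
        rw [pow_succ', Module.End.mul_apply, ih, _root_.map_smul, hR, smul_smul, pow_succ]
    have g1 : ∀ k : ℕ, Good ((E ^ k) ((t : ℂ) • 1)) R := by
      intro k
      have := (g.pow h k).smul (c := (μ ^ k)⁻¹) (by simp [hμ])
      rwa [hpow, smul_smul, inv_mul_cancel₀ (pow_ne_zero _ hμ0), one_smul] at this
    have g2 : ∀ m, Good ((t : ℂ) • C m) R := by
      intro m
      have := Good.avg g1 m
      rw [avg_const] at this
      convert this using 1
      rw [hC, avg, avg, smul_comm]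
      simp only [_root_.map_smul, Finset.smul_sum]
    exact Good.limit (fun m => g2 (φ m)) (hlim'.const_smul (t : ℂ)) tendsto_const_nhds

lemma Good.kill_right {A R Z : MatC n} (g : Good A R) (hZ : A * Z = 0) : R * Z = 0 := by
  have hv : ∀ y, A *ᵥ y = 0 → R *ᵥ y = 0 := by
    intro y hy
    have key : ∀ x, star x ⬝ᵥ R *ᵥ y = 0 := by
      intro x
      by_contra hne
      have hpos : 0 < ‖star x ⬝ᵥ R *ᵥ y‖ := norm_pos_iff.mpr hne
      obtain ⟨k, hk⟩ := exists_nat_gt ((star x ⬝ᵥ A *ᵥ x).re / ‖star x ⬝ᵥ R *ᵥ y‖)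
      rw [div_lt_iff₀ hpos] at hk
      have := g x ((k : ℂ) • y)
      simp only [Matrix.mulVec_smul, dotProduct_smul, hy, norm_smul, Complex.norm_natCast,
        smul_zero, dotProduct_zero, Complex.zero_re, add_zero] at this
      have h0 : 0 ≤ (k : ℝ) * ‖star x ⬝ᵥ R *ᵥ y‖ := by positivity
      linarith
    exact dotProduct_star_self_eq_zero.mp (key (R *ᵥ y))
  ext i j
  have h1 : A *ᵥ (fun k => Z k j) = 0 := by
    ext i; exact congrFun (congrFun hZ i) j
  exact congrFun (hv _ h1) i

lemma Good.kill_left {A R Z : MatC n} (g : Good A R) (hA : Aᴴ = A) (hZ : Z * A = 0) :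
    Z * R = 0 := by
  have g' : Good A Rᴴ := by
    intro x y
    have := g y x
    have h1 : star x ⬝ᵥ Rᴴ *ᵥ y = star (star y ⬝ᵥ R *ᵥ x) := by
      rw [← Matrix.star_dotProduct, Matrix.star_mulVec, Matrix.dotProduct_mulVec]
    rw [h1, norm_star]
    linarith
  have h2 : A * Zᴴ = 0 := by
    have := congrArg Matrix.conjTranspose hZ
    rwa [Matrix.conjTranspose_mul, hA, Matrix.conjTranspose_zero] at this
  have := congrArg Matrix.conjTranspose (g'.kill_right h2)
  simpa using this


lemma schwarz_eq (h : IsKraus E K) {ρ N : MatC n} {μ : ℂ} (hμ : ‖μ‖ = 1) (hρ : ρ.PosSemidef)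
    (hfix : E ρ = ρ) (hN : ∑ i, (K i)ᴴ * N * K i = μ • N) (i : κ) :
    (N * K i - μ • (K i * N)) * ρ = 0 := by
  have hμμ : star μ * μ = 1 := by
    rw [Complex.star_def, ← Complex.normSq_eq_conj_mul_self, Complex.normSq_eq_norm_sq, hμ]; simp
  set W : κ → MatC n := fun i => N * K i - μ • (K i * N) with hW
  have hN' : ∑ i, (K i)ᴴ * Nᴴ * K i = star μ • Nᴴ := by
    have := congrArg Matrix.conjTranspose hN
    rw [Matrix.conjTranspose_sum, Matrix.conjTranspose_smul] at this
    rw [← this]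
    refine Finset.sum_congr rfl fun i _ => ?_
    simp [Matrix.conjTranspose_mul, Matrix.mul_assoc]
  have hD : ∑ i, (W i)ᴴ * W i = (∑ i, (K i)ᴴ * (Nᴴ * N) * K i) - Nᴴ * N := by
    have e : ∀ i, (W i)ᴴ * W i = (K i)ᴴ * (Nᴴ * N) * K i - μ • (((K i)ᴴ * Nᴴ * K i) * N)
        - star μ • (Nᴴ * ((K i)ᴴ * N * K i)) + Nᴴ * ((K i)ᴴ * K i) * N := by
      intro i
      simp only [hW, Matrix.conjTranspose_sub, Matrix.conjTranspose_smul, Matrix.conjTranspose_mul,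
        Matrix.sub_mul, Matrix.mul_sub, Matrix.smul_mul, Matrix.mul_smul, smul_smul, hμμ, one_smul,
        smul_sub, Matrix.mul_assoc, mul_comm μ (star μ)]
      abel
    rw [Finset.sum_congr rfl fun i _ => e i, Finset.sum_add_distrib, Finset.sum_sub_distrib,
      Finset.sum_sub_distrib, ← Finset.smul_sum, ← Finset.smul_sum, ← Finset.sum_mul,
      ← Finset.mul_sum, ← Finset.sum_mul, ← Finset.mul_sum, hN, hN', h.2]
    simp only [Matrix.smul_mul, Matrix.mul_smul, smul_smul, hμμ, mul_comm μ (star μ), one_smul,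
      Matrix.mul_one]
    abel
  have htr : ∑ i, (W i * ρ * (W i)ᴴ).trace = 0 := by
    have e : ∀ i, (W i * ρ * (W i)ᴴ).trace = ((W i)ᴴ * W i * ρ).trace := fun i => by
      rw [Matrix.trace_mul_comm, Matrix.mul_assoc]
    rw [Finset.sum_congr rfl fun i _ => e i, ← Matrix.trace_sum, ← Finset.sum_mul, hD,
      Matrix.sub_mul, Matrix.trace_sub, sub_eq_zero, Finset.sum_mul, Matrix.trace_sum]
    conv_rhs => rw [← hfix, h.1, Finset.mul_sum, Matrix.trace_sum]
    refine Finset.sum_congr rfl fun i _ => ?_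
    rw [Matrix.mul_assoc, Matrix.mul_assoc, Matrix.trace_mul_comm]
    simp only [Matrix.mul_assoc]
  have hpsd : ∀ i, (W i * ρ * (W i)ᴴ).PosSemidef := fun i => hρ.mul_mul_conjTranspose_same (W i)
  have h0 : (W i * ρ * (W i)ᴴ).trace = 0 :=
    (Finset.sum_eq_zero_iff_of_nonneg fun j _ => (hpsd j).trace_nonneg).mp htr i (Finset.mem_univ i)
  obtain ⟨B, hB⟩ := exists_factor hρ
  have h1 : W i * Bᴴ = 0 := by
    rw [← Matrix.trace_mul_conjTranspose_self_eq_zero_iff, ← h0, hB]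
    simp [Matrix.conjTranspose_mul, Matrix.mul_assoc]
  change W i * ρ = 0
  rw [hB, ← Matrix.mul_assoc, h1, Matrix.zero_mul]

lemma fixed_eq (he : IsErgodic E) {ρ X : MatC n} (hρ1 : ρ.trace = 1) (hfix : E ρ = ρ)
    (hX : E X = X) : X = X.trace • ρ := by
  have hρ0 : ρ ≠ 0 := by rintro rfl; simp at hρ1
  have h1 : ρ ∈ Module.End.eigenspace E 1 := by simp [hfix]
  have h2 : X ∈ Module.End.eigenspace E 1 := by simp [hX]
  have h3 : (⟨ρ, h1⟩ : Module.End.eigenspace E 1) ≠ 0 := fun h => hρ0 (congrArg Subtype.val h)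
  obtain ⟨c, hc⟩ := (finrank_eq_one_iff_of_nonzero' _ h3).mp he ⟨X, h2⟩
  have hc' : c • ρ = X := congrArg Subtype.val hc
  rw [← hc', Matrix.trace_smul, hρ1]
  simp

lemma spectral_comm {P : MatC n →ₗ[ℂ] MatC n} {μ : ℂ} (hP : IsSpectralProjection E P μ)
    (Y : MatC n) : P (E Y) = E (P Y) := by
  have hc : Commute P E := by
    rw [LinearMap.IsIdempotentElem.commute_iff (f := P) hP.1, hP.2.1, hP.2.2]
    have hinv : ∀ ν, Module.End.maxGenEigenspace E ν ∈ Module.End.invtSubmodule E := fun ν =>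
      Module.End.mapsTo_maxGenEigenspace_of_comm (Commute.refl E) ν
    refine ⟨hinv μ, ?_⟩
    rw [Module.End.mem_invtSubmodule]
    refine iSup₂_le fun ν hν => ?_
    refine ((Module.End.mem_invtSubmodule E).mp (hinv ν)).trans ?_
    exact Submodule.comap_mono (le_iSup₂_of_le ν hν le_rfl)
  exact congrArg (fun f : Module.End ℂ (MatC n) => f Y) hc.eq

lemma spectral_key (h : IsKraus E K) (he : IsErgodic E) {ρ : MatC n} (hρ : ρ.PosSemidef)
    (hρ1 : ρ.trace = 1) (hfix : E ρ = ρ) {μ : ℂ} (hμ : ‖μ‖ = 1)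
    {P : MatC n →ₗ[ℂ] MatC n} (hP : IsSpectralProjection E P μ) (B Y : MatC n) :
    P (B * P Y) = (B * ρ).trace • P Y ∧ P (P Y * B) = (B * ρ).trace • P Y := by
  have hμμ : star μ * μ = 1 := by
    rw [Complex.star_def, ← Complex.normSq_eq_conj_mul_self, Complex.normSq_eq_norm_sq, hμ]; simp
  have hμ0 : μ ≠ 0 := fun h => by simp [h] at hμ
  have hERr : ∀ X, E (P X) = μ • P X := fun X =>
    maxGen_eq h hμ (by rw [← hP.2.1]; exact LinearMap.mem_range_self P X)
  have hPP : P (P Y) = P Y := congrArg (fun f : MatC n →ₗ[ℂ] MatC n => f Y) hP.1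
  set R := P Y with hR
  have hER : E R = μ • R := hERr Y
  -- support
  obtain ⟨A, hA, hAfix, -, hAg⟩ := exists_invariant h
  obtain ⟨t, g⟩ := hAg μ hμ R hER
  have hAρ := fixed_eq he hρ1 hfix hAfix
  rw [hAρ, smul_smul] at g
  have kr : ∀ Z, ρ * Z = 0 → R * Z = 0 := fun Z hZ => g.kill_right (by rw [Matrix.smul_mul, hZ, smul_zero])
  have kl : ∀ Z, Z * ρ = 0 → Z * R = 0 := by
    intro Z hZ
    refine g.kill_left ?_ (by rw [Matrix.mul_smul, hZ, smul_zero])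
    have h1 : star A.trace = A.trace := by rw [← Matrix.trace_conjTranspose, hA.1]
    rw [Matrix.conjTranspose_smul, hρ.1, star_mul', h1]
    simp
  have entry : ∀ i j, ∃ N : MatC n, ∀ Z, P Z i j = (N * Z).trace := by
    intro i j
    refine ⟨Matrix.of fun k l => P (Matrix.single l k 1) i j, fun Z => ?_⟩
    conv_lhs => rw [Matrix.matrix_eq_sum_single Z]
    simp only [map_sum, Matrix.sum_apply, Matrix.trace, Matrix.diag, Matrix.mul_apply, Matrix.of_apply]
    rw [Finset.sum_comm]
    refine Finset.sum_congr rfl fun k _ => Finset.sum_congr rfl fun l _ => ?_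
    have h3 : Matrix.single l k (Z l k) = Z l k • Matrix.single l k (1:ℂ) := by
      simp [Matrix.smul_single]
    rw [h3, _root_.map_smul, Matrix.smul_apply, smul_eq_mul, mul_comm]
  have main : ∀ i j, P (B * R) i j = (B * ρ).trace * R i j ∧ P (R * B) i j = (B * ρ).trace * R i j := by
    intro i j
    obtain ⟨N, hN⟩ := entry i j
    have hF : ∑ k, (K k)ᴴ * N * K k = μ • N := by
      rw [Matrix.ext_iff_trace_mul_right]
      intro X
      rw [Matrix.smul_mul, Matrix.trace_smul, ← hN, ← Matrix.smul_apply, ← hERr, ← spectral_comm hP,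
        hN, h.1, Finset.sum_mul, Finset.mul_sum, Matrix.trace_sum, Matrix.trace_sum]
      refine Finset.sum_congr rfl fun k _ => ?_
      rw [Matrix.mul_assoc, Matrix.mul_assoc, Matrix.trace_mul_comm]
      simp only [Matrix.mul_assoc]
    have hF' : ∑ k, (K k)ᴴ * Nᴴ * K k = star μ • Nᴴ := by
      have := congrArg Matrix.conjTranspose hF
      rw [Matrix.conjTranspose_sum, Matrix.conjTranspose_smul] at this
      rw [← this]
      refine Finset.sum_congr rfl fun i _ => ?_
      simp [Matrix.conjTranspose_mul, Matrix.mul_assoc]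
    have r1 : ∀ k, N * K k * R = μ • (K k * N * R) := by
      intro k
      have := kl _ (schwarz_eq h hμ hρ hfix hF k)
      rwa [Matrix.sub_mul, sub_eq_zero, Matrix.smul_mul] at this
    have r2 : ∀ k, R * (K k)ᴴ * N = μ • (R * N * (K k)ᴴ) := by
      intro k
      have h1 := congrArg Matrix.conjTranspose
        (schwarz_eq h (by rwa [norm_star]) hρ hfix hF' k)
      simp only [Matrix.conjTranspose_mul, Matrix.conjTranspose_sub, Matrix.conjTranspose_smul,
        Matrix.conjTranspose_conjTranspose, star_star, Matrix.conjTranspose_zero] at h1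
      rw [hρ.1.eq] at h1
      have := kr _ h1
      rw [Matrix.mul_sub, sub_eq_zero, Matrix.mul_smul] at this
      simpa [Matrix.mul_assoc] using this
    have f1 : E (N * R) = N * R := by
      have : μ • E (N * R) = μ • (N * R) := by
        rw [h.1, ← Matrix.mul_smul, ← hER, h.1, Finset.smul_sum, Finset.mul_sum]
        refine Finset.sum_congr rfl fun k _ => ?_
        rw [← Matrix.mul_assoc N, ← Matrix.mul_assoc N, r1, ← Matrix.mul_assoc, Matrix.smul_mul]
      exact smul_right_injective _ hμ0 this
    have f2 : E (R * N) = R * N := by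
      have : μ • E (R * N) = μ • (R * N) := by
        rw [h.1, ← Matrix.smul_mul, ← hER, h.1, Finset.smul_sum, Finset.sum_mul]
        refine Finset.sum_congr rfl fun k _ => ?_
        rw [Matrix.mul_assoc (K k), Matrix.mul_assoc (K k) R, Matrix.mul_assoc (K k) _ N, r2,
          Matrix.mul_smul]
      exact smul_right_injective _ hμ0 this
    have g1 := fixed_eq he hρ1 hfix f1
    have g2 := fixed_eq he hρ1 hfix f2
    have hRij : R i j = (N * R).trace := by rw [← hN, hPP]
    constructor
    · rw [hN, ← Matrix.mul_assoc, Matrix.trace_mul_cycle, g2, Matrix.trace_mul_comm R N, hRij,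
        Matrix.smul_mul, Matrix.trace_smul, smul_eq_mul, Matrix.trace_mul_comm ρ, mul_comm]
    · rw [hN, ← Matrix.mul_assoc, g1, Matrix.smul_mul, Matrix.trace_smul, smul_eq_mul, hRij,
        Matrix.trace_mul_comm ρ, mul_comm]
  exact ⟨Matrix.ext fun i j => (main i j).1, Matrix.ext fun i j => (main i j).2⟩


/-- Blocks of a bipartite operator. -/
def blk {d₁ d₂ : ℕ} (M : MatC2 d₁ d₂) (i j : Fin d₁) : MatC d₂ :=
  Matrix.of fun a b => M (i, a) (j, b)

section tensor
variable {d₁ d₂ : ℕ}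

lemma blk_ext {M M' : MatC2 d₁ d₂} (h : ∀ i j, blk M i j = blk M' i j) : M = M' := by
  ext ⟨i, a⟩ ⟨j, b⟩
  exact congrFun (congrFun (h i j) a) b

lemma blk_idTensor (P : MatC d₂ →ₗ[ℂ] MatC d₂) (M : MatC2 d₁ d₂) (i j : Fin d₁) :
    blk (idTensor P M) i j = P (blk M i j) := rfl

lemma blk_add (M M' : MatC2 d₁ d₂) (i j : Fin d₁) :
    blk (M + M') i j = blk M i j + blk M' i j := rfl

lemma blk_sub (M M' : MatC2 d₁ d₂) (i j : Fin d₁) :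
    blk (M - M') i j = blk M i j - blk M' i j := rfl

lemma blk_smul (c : ℂ) (M : MatC2 d₁ d₂) (i j : Fin d₁) :
    blk (c • M) i j = c • blk M i j := rfl

lemma blk_sum {ι : Type} (s : Finset ι) (M : ι → MatC2 d₁ d₂) (i j : Fin d₁) :
    blk (∑ k ∈ s, M k) i j = ∑ k ∈ s, blk (M k) i j := by
  ext a b
  simp [blk, Matrix.sum_apply]

lemma blk_kron (A : MatC d₁) (B : MatC d₂) (i j : Fin d₁) :
    blk (A ⊗ₖ B) i j = A i j • B := rfl

lemma blk_kron_mul (A : MatC d₁) (B : MatC d₂) (M : MatC2 d₁ d₂) (i j : Fin d₁) :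
    blk ((A ⊗ₖ B) * M) i j = ∑ k, A i k • (B * blk M k j) := by
  ext a b
  simp [blk, Matrix.mul_apply, Fintype.sum_prod_type, Matrix.sum_apply, Finset.mul_sum, mul_assoc]

lemma blk_mul_kron (A : MatC d₁) (B : MatC d₂) (M : MatC2 d₁ d₂) (i j : Fin d₁) :
    blk (M * (A ⊗ₖ B)) i j = ∑ k, A k j • (blk M i k * B) := by
  ext a b
  simp [blk, Matrix.mul_apply, Fintype.sum_prod_type, Matrix.sum_apply, Finset.mul_sum,
    mul_left_comm]

lemma idTensor_sum (S : Finset ℂ) (P : ℂ → MatC d₂ →ₗ[ℂ] MatC d₂) (M : MatC2 d₁ d₂) :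
    idTensor (∑ μ ∈ S, P μ) M = ∑ μ ∈ S, idTensor (P μ) M := by
  refine blk_ext fun i j => ?_
  simp only [blk_sum, blk_idTensor, LinearMap.sum_apply]

lemma left_key {P : MatC d₂ →ₗ[ℂ] MatC d₂} {τ : ℂ} {B : MatC d₂}
    (h : ∀ Y, P (B * P Y) = τ • P Y) (A : MatC d₁) (M : MatC2 d₁ d₂) :
    idTensor P ((A ⊗ₖ B) * idTensor P M) = τ • ((A ⊗ₖ (1 : MatC d₂)) * idTensor P M) := by
  refine blk_ext fun i j => ?_
  simp only [blk_idTensor, blk_kron_mul, blk_smul, map_sum, _root_.map_smul, h, Matrix.one_mul,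
    Finset.smul_sum]
  exact Finset.sum_congr rfl fun k _ => smul_comm _ _ _

lemma right_key {P : MatC d₂ →ₗ[ℂ] MatC d₂} {τ : ℂ} {B : MatC d₂}
    (h : ∀ Y, P (P Y * B) = τ • P Y) (A : MatC d₁) (M : MatC2 d₁ d₂) :
    idTensor P (idTensor P M * (A ⊗ₖ B)) = τ • (idTensor P M * (A ⊗ₖ (1 : MatC d₂))) := by
  refine blk_ext fun i j => ?_
  simp only [blk_idTensor, blk_mul_kron, blk_smul, map_sum, _root_.map_smul, h, Matrix.mul_one,
    Finset.smul_sum]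
  exact Finset.sum_congr rfl fun k _ => smul_comm _ _ _

lemma comm_key {P : MatC d₂ →ₗ[ℂ] MatC d₂} {ρ : MatC d₂} (hρ1 : ρ.trace = 1)
    (h : ∀ B Y, P (B * P Y) = (B * ρ).trace • P Y ∧ P (P Y * B) = (B * ρ).trace • P Y)
    {N : ℕ} (H₁ : MatC d₁) (H₂ : MatC d₂) (h₁ : Fin N → MatC d₁) (h₂ : Fin N → MatC d₂)
    (M : MatC2 d₁ d₂) :
    idTensor P ((H₁ ⊗ₖ (1 : MatC d₂) + (1 : MatC d₁) ⊗ₖ H₂ + ∑ i, h₁ i ⊗ₖ h₂ i) * idTensor P M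
      - idTensor P M * (H₁ ⊗ₖ (1 : MatC d₂) + (1 : MatC d₁) ⊗ₖ H₂ + ∑ i, h₁ i ⊗ₖ h₂ i))
    = ((H₁ + ∑ i, (h₂ i * ρ).trace • h₁ i) ⊗ₖ (1 : MatC d₂)) * idTensor P M
      - idTensor P M * ((H₁ + ∑ i, (h₂ i * ρ).trace • h₁ i) ⊗ₖ (1 : MatC d₂)) := by
  have hL := fun A B => left_key (fun Y => (h B Y).1) A M
  have hR := fun A B => right_key (fun Y => (h B Y).2) A M
  have hk : (H₁ + ∑ i, (h₂ i * ρ).trace • h₁ i) ⊗ₖ (1 : MatC d₂)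
      = H₁ ⊗ₖ (1 : MatC d₂) + ∑ i, (h₂ i * ρ).trace • (h₁ i ⊗ₖ (1 : MatC d₂)) := by
    refine blk_ext fun i j => ?_
    simp only [blk_add, blk_sum, blk_kron, blk_smul, Matrix.add_apply, Matrix.sum_apply,
      Matrix.smul_apply, add_smul, Finset.sum_smul, smul_smul, smul_eq_mul]
  rw [hk]
  simp only [add_mul, mul_add, Finset.sum_mul, Finset.mul_sum, map_sub, map_add, map_sum, hL, hR,
    Matrix.one_mul, hρ1, one_smul, Matrix.one_kronecker_one, Matrix.mul_one, Matrix.smul_mul,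
    Matrix.mul_smul]
  abel

lemma exists_spectral {n : ℕ} (E : MatC n →ₗ[ℂ] MatC n) (μ : ℂ) :
    ∃ P, IsSpectralProjection E P μ := by
  have hc : IsCompl (Module.End.maxGenEigenspace E μ)
      (⨆ ν ∈ {ν : ℂ | ν ≠ μ}, Module.End.maxGenEigenspace E ν) := by
    refine ⟨Module.End.independent_maxGenEigenspace E μ, ?_⟩
    rw [codisjoint_iff, eq_top_iff, ← Module.End.iSup_maxGenEigenspace_eq_top E]
    refine iSup_le fun ν => ?_
    by_cases hν : ν = μ
    · subst hν; exact le_sup_left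
    · exact le_sup_of_le_right (le_iSup₂_of_le (f := fun ν (_ : ν ∈ {ν : ℂ | ν ≠ μ}) =>
        Module.End.maxGenEigenspace E ν) ν hν le_rfl)
  exact ⟨Submodule.projection _ _ hc, Submodule.isIdempotentElem_projection hc,
    Submodule.range_projection hc, Submodule.ker_projection hc⟩

lemma spectral_trace {n : ℕ} {E P : MatC n →ₗ[ℂ] MatC n} (ht : ∀ A, (E A).trace = A.trace)
    (hP : IsSpectralProjection E P 1) (X : MatC n) : (P X).trace = X.trace := by
  have h1 : X - P X ∈ LinearMap.ker P := by
    have : P (P X) = P X := congrArg (fun f : MatC n →ₗ[ℂ] MatC n => f X) hP.1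
    simp [this]
  have h2 : LinearMap.ker P ≤ LinearMap.ker (Matrix.traceLinearMap (Fin n) ℂ ℂ) := by
    rw [hP.2.2]
    refine iSup₂_le fun ν hν v hv => ?_
    rw [Module.End.mem_maxGenEigenspace] at hv
    obtain ⟨k, hk⟩ := hv
    have h3 : ∀ k : ℕ, (((E - ν • (1 : Module.End ℂ (MatC n))) ^ k) v).trace
        = (1 - ν) ^ k * v.trace := by
      intro k
      induction k with
      | zero => simp
      | succ k ih =>
        rw [pow_succ', Module.End.mul_apply, LinearMap.sub_apply, Matrix.trace_sub, ht]
        simp only [LinearMap.smul_apply, Module.End.one_apply, Matrix.trace_smul, ih, smul_eq_mul]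
        ring
    have h4 := h3 k
    rw [hk, Matrix.trace_zero] at h4
    have h5 : (1 - ν) ^ k ≠ 0 := pow_ne_zero _ (sub_ne_zero.mpr (Ne.symm hν))
    have h6 : v.trace = 0 := by
      rcases mul_eq_zero.mp h4.symm with h | h
      · exact absurd h h5
      · exact h
    exact h6
  have h3 := h2 h1
  simp only [LinearMap.mem_ker, Matrix.traceLinearMap_apply, Matrix.trace_sub] at h3
  exact (sub_eq_zero.mp h3).symm

end tensor

/-- The constants for a given triple of data, used in the converse direction. -/
lemma converse_key {d₁ d₂ : ℕ} (hd₁ : 2 ≤ d₁)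
    {E : MatC d₂ →ₗ[ℂ] MatC d₂} (ht : ∀ A, (E A).trace = A.trace)
    {S : Finset ℂ} (hS1 : (1 : ℂ) ∈ S)
    {P : ℂ → (MatC d₂ →ₗ[ℂ] MatC d₂)} (hP : ∀ μ ∈ S, IsSpectralProjection E (P μ) μ)
    (hw : ∀ H : MatC2 d₁ d₂, H.IsHermitian →
      ∀ (N : ℕ) (H₁ : MatC d₁) (H₂ : MatC d₂) (h₁ : Fin N → MatC d₁) (h₂ : Fin N → MatC d₂),
        H = H₁ ⊗ₖ (1 : MatC d₂) + (1 : MatC d₁) ⊗ₖ H₂ + ∑ i, h₁ i ⊗ₖ h₂ i →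
        H₁.IsHermitian → H₂.IsHermitian → (∀ i, (h₁ i).IsHermitian) →
        (∀ i, (h₂ i).IsHermitian) →
        H₁.trace = 0 → H₂.trace = 0 → (∀ i, (h₁ i).trace = 0) → (∀ i, (h₂ i).trace = 0) →
        ∃ c : Fin N → ℝ, ∀ M : MatC2 d₁ d₂,
          ∑ μ ∈ S, idTensor (P μ) (H * idTensor (P μ) M - idTensor (P μ) M * H)
            = ((H₁ + ∑ i, (c i : ℂ) • h₁ i) ⊗ₖ (1 : MatC d₂)) * idTensor (∑ μ ∈ S, P μ) M
              - idTensor (∑ μ ∈ S, P μ) M * ((H₁ + ∑ i, (c i : ℂ) • h₁ i) ⊗ₖ (1 : MatC d₂)))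
    {g : MatC d₂} (hg : g.IsHermitian) (hg0 : g.trace = 0) :
    ∃ c : ℂ, ∀ R, E R = R → (g * R).trace = c * R.trace := by
  set i0 : Fin d₁ := ⟨0, by omega⟩
  set i1 : Fin d₁ := ⟨1, by omega⟩
  have h01 : i0 ≠ i1 := by simp [i0, i1, Fin.ext_iff]
  set D : Fin d₁ → ℂ := fun i => if i = i0 then 1 else if i = i1 then -1 else 0 with hD
  set Z : MatC d₁ := Matrix.diagonal D with hZ
  have hZh : Z.IsHermitian := by
    rw [hZ, Matrix.IsHermitian, Matrix.diagonal_conjTranspose]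
    congr 1
    ext i
    simp only [hD, Pi.star_apply]
    split_ifs <;> simp
  have hZt : Z.trace = 0 := by
    rw [hZ, Matrix.trace_diagonal]
    have : ∀ i, D i = (if i = i0 then 1 else 0) + (if i = i1 then -1 else 0) := by
      intro i
      simp only [hD]
      by_cases h : i = i0
      · subst h; simp [h01]
      · simp [h]
    simp only [this, Finset.sum_add_distrib]
    simp
  obtain ⟨c, hc⟩ := hw (Z ⊗ₖ g) (by
      rw [Matrix.IsHermitian, Matrix.conjTranspose_kronecker, hZh.eq, hg.eq]) 1 0 0
    (fun _ => Z) (fun _ => g) (by simp) (by simp) (by simp) (fun _ => hZh)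
    (fun _ => hg) (by simp) (by simp) (fun _ => hZt) (fun _ => hg0)
  refine ⟨c 0, fun R hR => ?_⟩
  have hRm : R ∈ Module.End.maxGenEigenspace E 1 := by
    rw [Module.End.mem_maxGenEigenspace]
    exact ⟨1, by simp [hR]⟩
  have hP1 : P 1 R = R := by
    have h1 : R ∈ LinearMap.range (P 1) := by rw [(hP 1 hS1).2.1]; exact hRm
    obtain ⟨Y, rfl⟩ := h1
    exact congrArg (fun f : MatC d₂ →ₗ[ℂ] MatC d₂ => f Y) (hP 1 hS1).1
  have hP0 : ∀ μ ∈ S, μ ≠ 1 → P μ R = 0 := by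
    intro μ hμ hne
    have h1 : R ∈ LinearMap.ker (P μ) := by
      rw [(hP μ hμ).2.2]
      exact (le_iSup₂_of_le (f := fun ν (_ : ν ∈ {ν : ℂ | ν ≠ μ}) =>
        Module.End.maxGenEigenspace E ν) 1 hne.symm le_rfl) hRm
    exact h1
  have h2 := congrArg (fun M => (blk M i0 i1).trace) (hc (Matrix.single i0 i1 (1:ℂ) ⊗ₖ R))
  have hsum : ∀ k, ∑ x ∈ S, P x (Matrix.single i0 i1 (1:ℂ) i0 k • R) =
      Matrix.single i0 i1 (1:ℂ) i0 k • R := by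
    intro k
    rw [Finset.sum_eq_single_of_mem 1 hS1]
    · rw [_root_.map_smul, hP1]
    · intro μ hμ hne; rw [_root_.map_smul, hP0 μ hμ hne, smul_zero]
  have hsum' : ∀ k, ∑ x ∈ S, P x (Matrix.single i0 i1 (1:ℂ) k i1 • R) =
      Matrix.single i0 i1 (1:ℂ) k i1 • R := by
    intro k
    rw [Finset.sum_eq_single_of_mem 1 hS1]
    · rw [_root_.map_smul, hP1]
    · intro μ hμ hne; rw [_root_.map_smul, hP0 μ hμ hne, smul_zero]
  have hzero : ∀ μ ∈ S, μ ≠ 1 → P μ (∑ k, Z i0 k • (g * P μ (Matrix.single i0 i1 (1:ℂ) k i1 • R))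
      - ∑ k, Z k i1 • (P μ (Matrix.single i0 i1 (1:ℂ) i0 k • R) * g)) = 0 := by
    intro μ hμ hne
    simp [_root_.map_smul, hP0 μ hμ hne]
  simp only [blk_sum, blk_sub, blk_idTensor, blk_kron_mul, blk_mul_kron, blk_kron,
    LinearMap.sum_apply, hsum, hsum'] at h2
  rw [Finset.sum_eq_single_of_mem 1 hS1 hzero, spectral_trace ht (hP 1 hS1)] at h2
  simp only [_root_.map_smul, hP1, Matrix.trace_sub, Matrix.trace_sum, Matrix.trace_smul,
    Matrix.mul_smul, Matrix.smul_mul, Matrix.single_apply, hZ, Matrix.diagonal_apply, smul_eq_mul,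
    Matrix.add_apply, Matrix.sum_apply, Matrix.smul_apply, Matrix.zero_apply, one_mul, mul_one] at h2
  simp [hD, h01.symm, Matrix.trace_mul_comm R g] at h2
  linear_combination h2 / 2


lemma ergodic_of_traceless {n : ℕ} {E : MatC n →ₗ[ℂ] MatC n} {ρ : MatC n} (hρ1 : ρ.trace = 1)
    (hfix : E ρ = ρ) (hz : ∀ Z, E Z = Z → Z.trace = 0 → Z = 0) : IsErgodic E := by
  have hρ0 : ρ ≠ 0 := by rintro rfl; simp at hρ1
  have h1 : ρ ∈ Module.End.eigenspace E 1 := by simp [hfix]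
  have h3 : (⟨ρ, h1⟩ : Module.End.eigenspace E 1) ≠ 0 := fun h => hρ0 (congrArg Subtype.val h)
  refine (finrank_eq_one_iff_of_nonzero' _ h3).mpr ?_
  rintro ⟨X, hX⟩
  have hX' : E X = X := by simpa using hX
  refine ⟨X.trace, Subtype.ext ?_⟩
  have := hz (X - X.trace • ρ) (by rw [map_sub, _root_.map_smul, hX', hfix]) (by simp [hρ1])
  exact (sub_eq_zero.mp this).symm

lemma exists_state {n : ℕ} (hn : 2 ≤ n) {E : MatC n →ₗ[ℂ] MatC n} (hE : IsQuantumChannel E) :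
    ∃ ρ : MatC n, ρ.PosSemidef ∧ ρ.trace = 1 ∧ E ρ = ρ := by
  obtain ⟨K, hK⟩ := exists_kraus hE
  obtain ⟨A, hA, hAf, hAt, -⟩ := exists_invariant hK
  have hn0 : (n : ℂ) ≠ 0 := by exact_mod_cast (by omega : n ≠ 0)
  refine ⟨((n : ℝ)⁻¹) • A, hA.smul (by positivity), ?_, ?_⟩
  · rw [Matrix.trace_smul, hAt, Complex.real_smul]
    push_cast
    exact inv_mul_cancel₀ hn0
  · rw [LinearMap.map_smul_of_tower, hAf]

lemma forward_key {d₁ d₂ : ℕ} {E₂ : MatC d₂ →ₗ[ℂ] MatC d₂} (hE₂ : IsQuantumChannel E₂)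
    (he : IsErgodic E₂) {ρ : MatC d₂} (hρ : ρ.PosSemidef) (hρ1 : ρ.trace = 1) (hfix : E₂ ρ = ρ)
    {S : Finset ℂ} (hS : ∀ μ : ℂ, μ ∈ S ↔ (Module.End.HasEigenvalue E₂ μ ∧ ‖μ‖ = 1))
    {P : ℂ → (MatC d₂ →ₗ[ℂ] MatC d₂)} (hP : ∀ μ ∈ S, IsSpectralProjection E₂ (P μ) μ)
    {N : ℕ} (H₁ : MatC d₁) (H₂ : MatC d₂) (h₁ : Fin N → MatC d₁) (h₂ : Fin N → MatC d₂)
    (M : MatC2 d₁ d₂) :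
    ∑ μ ∈ S, idTensor (P μ) ((H₁ ⊗ₖ (1 : MatC d₂) + (1 : MatC d₁) ⊗ₖ H₂ + ∑ i, h₁ i ⊗ₖ h₂ i)
        * idTensor (P μ) M - idTensor (P μ) M *
        (H₁ ⊗ₖ (1 : MatC d₂) + (1 : MatC d₁) ⊗ₖ H₂ + ∑ i, h₁ i ⊗ₖ h₂ i))
      = ((H₁ + ∑ i, (h₂ i * ρ).trace • h₁ i) ⊗ₖ (1 : MatC d₂)) * idTensor (∑ μ ∈ S, P μ) M
        - idTensor (∑ μ ∈ S, P μ) M * ((H₁ + ∑ i, (h₂ i * ρ).trace • h₁ i) ⊗ₖ (1 : MatC d₂)) := by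
  obtain ⟨K, hK⟩ := exists_kraus hE₂
  rw [idTensor_sum, Finset.mul_sum, Finset.sum_mul, ← Finset.sum_sub_distrib]
  exact Finset.sum_congr rfl fun μ hμ => comm_key hρ1
    (spectral_key hK he hρ hρ1 hfix ((hS μ).mp hμ).2 (hP μ hμ)) H₁ H₂ h₁ h₂ M

end BDD

/-- **Condition for bath dynamical decoupling (Theorem 1).**
Bath dynamical decoupling with the quantum channel `𝓔 = 𝓘₁ ⊗ 𝓔₂` works — i.e. for every
(traceless Hermitian) Hamiltonian `H = H₁⊗𝟙 + 𝟙⊗H₂ + Σᵢ h₁⁽ⁱ⁾⊗h₂⁽ⁱ⁾` (operator Schmidt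
decomposition with traceless Hermitian parts) the Zeno Hamiltonian
`𝓗_Z = Σ_{|λ_ℓ|=1} (𝓘₁⊗P_ℓ)[H,·](𝓘₁⊗P_ℓ)` equals
`([H₁ + Σᵢ cᵢ h₁⁽ⁱ⁾, ·] ⊗ 𝓘₂) ∘ (𝓘₁⊗P_φ)` for some real constants `cᵢ` — if and only if
`𝓔₂` is ergodic.  In that case the constants are `cᵢ = tr(h₂⁽ⁱ⁾ ρ*)`, with `ρ*` the unique
fixed-point state of `𝓔₂`. -/
theorem bath_dynamical_decoupling_iff_ergodic {d₁ d₂ : ℕ} (hd₁ : 2 ≤ d₁) (hd₂ : 2 ≤ d₂)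
    (E₂ : MatC d₂ →ₗ[ℂ] MatC d₂) (hE₂ : IsQuantumChannel E₂) :
    ((∀ S : Finset ℂ, (∀ μ : ℂ, μ ∈ S ↔ (Module.End.HasEigenvalue E₂ μ ∧ ‖μ‖ = 1)) →
      ∀ P : ℂ → (MatC d₂ →ₗ[ℂ] MatC d₂), (∀ μ ∈ S, IsSpectralProjection E₂ (P μ) μ) →
      ∀ H : MatC2 d₁ d₂, H.IsHermitian →
      ∀ (N : ℕ) (H₁ : MatC d₁) (H₂ : MatC d₂) (h₁ : Fin N → MatC d₁) (h₂ : Fin N → MatC d₂),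
        H = H₁ ⊗ₖ (1 : MatC d₂) + (1 : MatC d₁) ⊗ₖ H₂ + ∑ i, h₁ i ⊗ₖ h₂ i →
        H₁.IsHermitian → H₂.IsHermitian → (∀ i, (h₁ i).IsHermitian) →
        (∀ i, (h₂ i).IsHermitian) →
        H₁.trace = 0 → H₂.trace = 0 → (∀ i, (h₁ i).trace = 0) → (∀ i, (h₂ i).trace = 0) →
        ∃ c : Fin N → ℝ, ∀ M : MatC2 d₁ d₂,
          ∑ μ ∈ S, idTensor (P μ) (H * idTensor (P μ) M - idTensor (P μ) M * H)
            = ((H₁ + ∑ i, (c i : ℂ) • h₁ i) ⊗ₖ (1 : MatC d₂)) * idTensor (∑ μ ∈ S, P μ) M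
              - idTensor (∑ μ ∈ S, P μ) M * ((H₁ + ∑ i, (c i : ℂ) • h₁ i) ⊗ₖ (1 : MatC d₂)))
      ↔ IsErgodic E₂) ∧
    (IsErgodic E₂ →
      ∀ ρstar : MatC d₂, ρstar.PosSemidef → ρstar.trace = 1 → E₂ ρstar = ρstar →
      ∀ S : Finset ℂ, (∀ μ : ℂ, μ ∈ S ↔ (Module.End.HasEigenvalue E₂ μ ∧ ‖μ‖ = 1)) →
      ∀ P : ℂ → (MatC d₂ →ₗ[ℂ] MatC d₂), (∀ μ ∈ S, IsSpectralProjection E₂ (P μ) μ) →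
      ∀ H : MatC2 d₁ d₂, H.IsHermitian →
      ∀ (N : ℕ) (H₁ : MatC d₁) (H₂ : MatC d₂) (h₁ : Fin N → MatC d₁) (h₂ : Fin N → MatC d₂),
        H = H₁ ⊗ₖ (1 : MatC d₂) + (1 : MatC d₁) ⊗ₖ H₂ + ∑ i, h₁ i ⊗ₖ h₂ i →
        H₁.IsHermitian → H₂.IsHermitian → (∀ i, (h₁ i).IsHermitian) →
        (∀ i, (h₂ i).IsHermitian) →
        H₁.trace = 0 → H₂.trace = 0 → (∀ i, (h₁ i).trace = 0) → (∀ i, (h₂ i).trace = 0) →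
        ∀ M : MatC2 d₁ d₂,
          ∑ μ ∈ S, idTensor (P μ) (H * idTensor (P μ) M - idTensor (P μ) M * H)
            = ((H₁ + ∑ i, (h₂ i * ρstar).trace • h₁ i) ⊗ₖ (1 : MatC d₂))
                * idTensor (∑ μ ∈ S, P μ) M
              - idTensor (∑ μ ∈ S, P μ) M
                * ((H₁ + ∑ i, (h₂ i * ρstar).trace • h₁ i) ⊗ₖ (1 : MatC d₂))) := by
  refine ⟨⟨fun hw => ?_, fun he => ?_⟩, ?_⟩
  · obtain ⟨ρ, hρ, hρ1, hfix⟩ := BDD.exists_state hd₂ hE₂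
    have hρ0 : ρ ≠ 0 := by rintro rfl; simp at hρ1
    have hfin : Set.Finite {μ : ℂ | Module.End.HasEigenvalue E₂ μ ∧ ‖μ‖ = 1} :=
      (Module.End.finite_hasEigenvalue E₂).subset fun μ h => h.1
    have hS : ∀ μ : ℂ, μ ∈ hfin.toFinset ↔ (Module.End.HasEigenvalue E₂ μ ∧ ‖μ‖ = 1) :=
      fun μ => by simp
    choose P hP using fun μ => BDD.exists_spectral E₂ μ
    have hS1 : (1 : ℂ) ∈ hfin.toFinset := by
      rw [hS]
      exact ⟨Module.End.hasEigenvalue_of_hasEigenvector (x := ρ) ⟨by simp [hfix], hρ0⟩, by simp⟩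
    have hw' := hw _ hS P (fun μ _ => hP μ)
    refine BDD.ergodic_of_traceless hρ1 hfix fun Z hZ hZt => ?_
    have key : ∀ g : MatC d₂, g.IsHermitian → g.trace = 0 → (g * Z).trace = 0 := by
      intro g hg hg0
      obtain ⟨c, hc⟩ := BDD.converse_key hd₁ hE₂.2 hS1 (fun μ _ => hP μ) hw' hg hg0
      rw [hc Z hZ, hZt, mul_zero]
    have k1 := key (Z + Zᴴ) (Matrix.isHermitian_add_transpose_self Z)
      (by simp [Matrix.trace_conjTranspose, hZt])
    have k2 := key (Complex.I • (Z - Zᴴ)) (by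
        rw [Matrix.IsHermitian, Matrix.conjTranspose_smul, Matrix.conjTranspose_sub,
          Matrix.conjTranspose_conjTranspose, Complex.star_def, Complex.conj_I, neg_smul,
          ← smul_neg, neg_sub])
      (by simp [Matrix.trace_conjTranspose, hZt])
    rw [Matrix.smul_mul, Matrix.trace_smul, smul_eq_mul, Matrix.sub_mul, Matrix.trace_sub] at k2
    rw [Matrix.add_mul, Matrix.trace_add] at k1
    have k3 : (Z * Z).trace - (Zᴴ * Z).trace = 0 := (mul_eq_zero.mp k2).resolve_left Complex.I_ne_zero
    refine Matrix.trace_conjTranspose_mul_self_eq_zero_iff.mp ?_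
    linear_combination k1 / 2 - k3 / 2
  · obtain ⟨ρ, hρ, hρ1, hfix⟩ := BDD.exists_state hd₂ hE₂
    intro S hS P hP H hH N H₁ H₂ h₁ h₂ hHe _ _ _ hh₂ _ _ _ _
    refine ⟨fun i => ((h₂ i * ρ).trace).re, fun M => ?_⟩
    have hre : ∀ i, ((((h₂ i * ρ).trace).re : ℝ) : ℂ) = (h₂ i * ρ).trace := by
      intro i
      rw [← Complex.conj_eq_iff_re, ← Complex.star_def, ← Matrix.trace_conjTranspose,
        Matrix.conjTranspose_mul, (hh₂ i).eq, hρ.1.eq, Matrix.trace_mul_comm]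
    simp only [hre]
    subst hHe
    exact BDD.forward_key hE₂ he hρ hρ1 hfix hS hP H₁ H₂ h₁ h₂ M
  · intro he ρ hρ hρ1 hfix S hS P hP H hH N H₁ H₂ h₁ h₂ hHe _ _ _ _ _ _ _ _ M
    subst hHe
    exact BDD.forward_key hE₂ he hρ hρ1 hfix hS hP H₁ H₂ h₁ h₂ M
end
end

section
/- Let 𝓔₂ : B(ℋ₂) → B(ℋ₂) be an ergodic quantum channel with unique fixed-point state ρ*, peripheral spectral projections P_ℓ and peripheral projection P_φ = Σ_ℓ P_ℓ, and let H = H† ∈ B(ℋ₁⊗ℋ₂) be any Hamiltonian. Then for all product operators A₁⊗A₂ ∈ B(ℋ₁⊗ℋ₂), Σ_{|λ_ℓ|=1} [(𝓘₁⊗P_ℓ) ∘ [H,·] ∘ (𝓘₁⊗P_ℓ)](A₁⊗A₂) = [tr₂((𝟙₁⊗ρ*)H), A₁] ⊗ P_φ(A₂), where tr₂ denotes the partial trace over ℋ₂. -/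
open Matrix Kronecker
open scoped ComplexOrder
noncomputable section

/-- Partial trace over the second tensor factor. -/
def ptr₂ {d₁ d₂ : ℕ} : MatC2 d₁ d₂ →ₗ[ℂ] MatC d₁ where
  toFun M := Matrix.of fun i j => ∑ a, M (i, a) (j, a)
  map_add' M N := by
    ext i j
    simp [Finset.sum_add_distrib]
  map_smul' c M := by
    ext i j
    simp [Finset.mul_sum]


section ZenoHelpers

open scoped MatrixOrder

lemma psd_factor {ι : Type*} [Fintype ι] [DecidableEq ι] {A : Matrix ι ι ℂ} (hA : A.PosSemidef) :
    ∃ B : Matrix ι ι ℂ, A = Bᴴ * B := by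
  obtain ⟨B, hB⟩ := CStarAlgebra.nonneg_iff_eq_star_mul_self.mp (Matrix.nonneg_iff_posSemidef.mpr hA)
  exact ⟨B, hB⟩

lemma psd_le_bound {n : ℕ} {Y : MatC n} (hY : Y.IsHermitian) :
    ∃ a : ℝ, ((a : ℂ) • (1 : MatC n) - Y).PosSemidef := by
  open scoped Matrix.Norms.L2Operator in
  have h := IsSelfAdjoint.le_algebraMap_norm_self (a := Y) hY
  rw [Matrix.le_iff, Algebra.algebraMap_eq_smul_one] at h
  generalize ‖Y‖ = a at h
  refine ⟨a, ?_⟩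
  have e : (a : ℂ) • (1 : MatC n) = a • (1 : MatC n) := by
    ext i j
    simp [Matrix.smul_apply]
  rw [e]
  exact h

lemma psd_trace_zero {n : ℕ} {ρ C : MatC n} (hρ : ρ.PosSemidef)
    (h : (C * ρ * Cᴴ).trace = 0) : C * ρ = 0 := by
  obtain ⟨B, rfl⟩ := psd_factor hρ
  have : ((B * Cᴴ)ᴴ * (B * Cᴴ)).trace = 0 := by
    rw [← h]; simp [Matrix.mul_assoc]
  rw [Matrix.trace_conjTranspose_mul_self_eq_zero_iff] at this
  have h2 := congrArg Matrix.conjTranspose this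
  simp at h2
  rw [← Matrix.mul_assoc, h2, Matrix.zero_mul]

lemma psd_trace_zero' {n : ℕ} {ρ A : MatC n} (hρ : ρ.PosSemidef) (hA : A.PosSemidef)
    (h : (ρ * A).trace = 0) : A * ρ = 0 := by
  obtain ⟨T, rfl⟩ := psd_factor hA
  have : T * ρ = 0 := by
    apply psd_trace_zero hρ
    rw [← h, Matrix.trace_mul_comm, Matrix.trace_mul_comm ρ, Matrix.mul_assoc]
  rw [Matrix.mul_assoc, this, Matrix.mul_zero]

lemma dual_eq_trace {n : ℕ} (f : Module.Dual ℂ (MatC n)) :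
    ∃ Z : MatC n, ∀ X, f X = (Z * X).trace := by
  refine ⟨Matrix.of fun i j => f (Matrix.single j i 1), fun X => ?_⟩
  conv_lhs => rw [Matrix.matrix_eq_sum_single X]
  simp only [map_sum, Matrix.trace, Matrix.diag, Matrix.mul_apply, Matrix.of_apply]
  rw [Finset.sum_comm]
  refine Finset.sum_congr rfl fun i _ => Finset.sum_congr rfl fun j _ => ?_
  have : Matrix.single j i (X j i) = X j i • Matrix.single j i (1 : ℂ) := by simp
  rw [this, _root_.map_smul, smul_eq_mul, mul_comm]

lemma channel_kraus {n : ℕ} {E : MatC n →ₗ[ℂ] MatC n} (hE : IsQuantumChannel E) :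
    ∃ K : Fin n × Fin n → MatC n, (∀ X, E X = ∑ k, K k * X * (K k)ᴴ) ∧
      ∑ k, (K k)ᴴ * K k = 1 := by
  obtain ⟨B, hB⟩ := psd_factor hE.1
  have hK : ∀ X, E X = ∑ k, (Matrix.of fun i a => star (B k (i, a))) * X *
      (Matrix.of fun i a => star (B k (i, a)) : MatC n)ᴴ := by
    intro X
    ext i j
    conv_lhs => rw [Matrix.matrix_eq_sum_single X]
    simp only [map_sum, Matrix.sum_apply, Matrix.mul_apply, Matrix.conjTranspose_apply,
      Matrix.of_apply, star_star, Finset.sum_mul]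
    have h1 : ∀ a b, E (Matrix.single a b (X a b)) i j
        = ∑ k, star (B k (i, a)) * X a b * B k (j, b) := by
      intro a b
      have : Matrix.single a b (X a b) = X a b • Matrix.single a b (1 : ℂ) := by simp
      rw [this, _root_.map_smul, Matrix.smul_apply, smul_eq_mul]
      have h2 := congrFun (congrFun hB (i, a)) (j, b)
      simp only [choi, Matrix.mul_apply, Matrix.conjTranspose_apply] at h2
      rw [h2, Finset.mul_sum]
      exact Finset.sum_congr rfl fun k _ => by ring
    simp only [h1]
    calc _ = ∑ a, ∑ k, ∑ b, star (B k (i, a)) * X a b * B k (j, b) :=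
          Finset.sum_congr rfl fun a _ => Finset.sum_comm
      _ = ∑ k, ∑ a, ∑ b, star (B k (i, a)) * X a b * B k (j, b) := Finset.sum_comm
      _ = _ := Finset.sum_congr rfl fun k _ => Finset.sum_comm
  refine ⟨_, hK, ?_⟩
  rw [Matrix.ext_iff_trace_mul_left]
  intro X
  rw [Matrix.mul_one, ← hE.2 X, hK X, Finset.mul_sum, Matrix.trace_sum, Matrix.trace_sum]
  refine Finset.sum_congr rfl fun k _ => ?_
  rw [← Matrix.mul_assoc, Matrix.trace_mul_comm, Matrix.mul_assoc]

/-- Heisenberg-picture map. -/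
def heis {n : ℕ} {κ : Type} [Fintype κ] (K : κ → MatC n) : MatC n →ₗ[ℂ] MatC n where
  toFun X := ∑ k, (K k)ᴴ * X * K k
  map_add' X Y := by simp [Matrix.mul_add, Matrix.add_mul, Finset.sum_add_distrib]
  map_smul' c X := by simp [Finset.smul_sum]

lemma heis_apply {n : ℕ} {κ : Type} [Fintype κ] (K : κ → MatC n) (X : MatC n) :
    heis K X = ∑ k, (K k)ᴴ * X * K k := rfl

lemma heis_star {n : ℕ} {κ : Type} [Fintype κ] (K : κ → MatC n) (X : MatC n) :
    heis K Xᴴ = (heis K X)ᴴ := by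
  simp [heis_apply, Matrix.conjTranspose_sum, Matrix.mul_assoc]

lemma heis_psd {n : ℕ} {κ : Type} [Fintype κ] (K : κ → MatC n) {X : MatC n}
    (hX : X.PosSemidef) : (heis K X).PosSemidef :=
  Matrix.posSemidef_sum _ fun k _ => hX.conjTranspose_mul_mul_same (K k)

lemma heis_one {n : ℕ} {κ : Type} [Fintype κ] {K : κ → MatC n}
    (h1 : ∑ k, (K k)ᴴ * K k = 1) : heis K 1 = 1 := by
  simp [heis_apply, h1]

lemma heis_trace {n : ℕ} {κ : Type} [Fintype κ] {K : κ → MatC n} {E : MatC n →ₗ[ℂ] MatC n}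
    (hK : ∀ X, E X = ∑ k, K k * X * (K k)ᴴ) (X Y : MatC n) :
    (heis K X * Y).trace = (X * E Y).trace := by
  rw [heis_apply, hK, Finset.sum_mul, Finset.mul_sum, Matrix.trace_sum, Matrix.trace_sum]
  refine Finset.sum_congr rfl fun k _ => ?_
  rw [Matrix.mul_assoc, Matrix.mul_assoc, Matrix.trace_mul_comm]
  simp only [Matrix.mul_assoc]

/-- `F X ≥ X` implies `X ≤ tr(ρ X)`. -/
lemma subharmonic {n : ℕ} {κ : Type} [Fintype κ] {K : κ → MatC n} {E : MatC n →ₗ[ℂ] MatC n}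
    (hK : ∀ X, E X = ∑ k, K k * X * (K k)ᴴ) (h1 : ∑ k, (K k)ᴴ * K k = 1)
    {ρ : MatC n} (hρ : ρ.PosSemidef) (hρtr : ρ.trace = 1)
    (huniq : ∀ X, E X = X → ∃ a : ℂ, X = a • ρ)
    {X : MatC n} (hX : X.IsHermitian) (hsub : (heis K X - X).PosSemidef) :
    ((ρ * X).trace • (1 : MatC n) - X).PosSemidef := by
  set c := (ρ * X).trace with hc
  have hcreal : star c = c := by
    rw [hc, ← Matrix.trace_conjTranspose, Matrix.conjTranspose_mul, hX, hρ.1,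
      Matrix.trace_mul_comm]
  have hDh : (X - c • (1 : MatC n))ᴴ = X - c • (1 : MatC n) := by
    rw [Matrix.conjTranspose_sub, Matrix.conjTranspose_smul, hcreal, hX]; simp
  have hmem : X - c • 1 ∈ LinearMap.range (heis K - LinearMap.id) := by
    by_contra hn
    obtain ⟨f, hf, hle⟩ := Submodule.exists_le_ker_of_notMem hn
    obtain ⟨Z, hZ⟩ := dual_eq_trace f
    have hEZ : E Z = Z := by
      rw [Matrix.ext_iff_trace_mul_left]
      intro Y
      have := hle (LinearMap.mem_range_self (heis K - LinearMap.id) Y)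
      rw [LinearMap.mem_ker, hZ, LinearMap.sub_apply, LinearMap.id_apply, Matrix.mul_sub,
        Matrix.trace_sub, sub_eq_zero, Matrix.trace_mul_comm, heis_trace hK] at this
      rw [this, Matrix.trace_mul_comm]
    obtain ⟨a, rfl⟩ := huniq Z hEZ
    apply hf
    rw [hZ]
    simp [Matrix.mul_sub, hρtr, ← hc]
  obtain ⟨Y₀, hY₀⟩ := hmem
  rw [LinearMap.sub_apply, LinearMap.id_apply] at hY₀
  obtain ⟨Y, hYh, hY⟩ : ∃ Y : MatC n, Y.IsHermitian ∧ heis K Y - Y = X - c • 1 := by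
    refine ⟨(1/2 : ℂ) • (Y₀ + Y₀ᴴ), ?_, ?_⟩
    · unfold Matrix.IsHermitian
      rw [Matrix.conjTranspose_smul, Matrix.conjTranspose_add, Matrix.conjTranspose_conjTranspose,
        add_comm]
      simp
    · have h2 := congrArg Matrix.conjTranspose hY₀
      rw [hDh, Matrix.conjTranspose_sub, ← heis_star] at h2
      rw [_root_.map_smul, map_add, ← smul_sub, add_sub_add_comm, hY₀, h2, ← two_smul ℂ, smul_smul]
      norm_num
  obtain ⟨a, ha⟩ := psd_le_bound hYh
  have step1 : ∀ N : ℕ, ((heis K ^ N) Y - Y - (N : ℂ) • (X - c • (1 : MatC n))).PosSemidef := by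
    intro N
    induction N with
    | zero => simpa using Matrix.PosSemidef.zero
    | succ N ih =>
      have h3 := (heis_psd K ih).add (hsub.smul (α := ℂ) (a := (N : ℂ)) (by exact_mod_cast Nat.zero_le N))
      convert h3 using 1
      rw [pow_succ', Module.End.mul_apply, map_sub, map_sub, _root_.map_smul, map_sub,
        _root_.map_smul, heis_one h1, sub_eq_iff_eq_add.mp hY]
      push_cast
      module
  have step2 : ∀ N : ℕ, ((a : ℂ) • (1 : MatC n) - (heis K ^ N) Y).PosSemidef := by
    intro N
    induction N with
    | zero => simpa using ha
    | succ N ih =>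
      convert heis_psd K ih using 1
      rw [pow_succ', Module.End.mul_apply, map_sub, _root_.map_smul, heis_one h1]
  have step3 : ∀ N : ℕ,
      (((a : ℂ) • (1 : MatC n) - Y) + (N : ℂ) • (c • (1 : MatC n) - X)).PosSemidef := by
    intro N
    convert (step1 N).add (step2 N) using 1
    module
  have hherm : (c • (1 : MatC n) - X).IsHermitian := by
    unfold Matrix.IsHermitian
    rw [← neg_sub, Matrix.conjTranspose_neg, hDh]
  refine Matrix.PosSemidef.of_dotProduct_mulVec_nonneg hherm fun v => ?_
  have him : (star v ⬝ᵥ (c • (1 : MatC n) - X) *ᵥ v).im = 0 :=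
    hherm.im_star_dotProduct_mulVec_self v
  rw [Complex.nonneg_iff]
  refine ⟨?_, him.symm⟩
  by_contra hneg
  push Not at hneg
  set q := (star v ⬝ᵥ (c • (1 : MatC n) - X) *ᵥ v) with hq
  set r := (star v ⬝ᵥ ((a : ℂ) • (1 : MatC n) - Y) *ᵥ v) with hr
  obtain ⟨N, hN⟩ := exists_nat_gt (r.re / (-q.re))
  have h4 := (step3 N).dotProduct_mulVec_nonneg v
  rw [Matrix.add_mulVec, Matrix.smul_mulVec, dotProduct_add, dotProduct_smul, ← hq, ← hr,
    Complex.nonneg_iff] at h4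
  have h5 := h4.1
  simp at h5
  rw [div_lt_iff₀ (by linarith)] at hN
  linarith

lemma eig_facts {n : ℕ} {κ : Type} [Fintype κ] {K : κ → MatC n} {E : MatC n →ₗ[ℂ] MatC n}
    (hK : ∀ X, E X = ∑ k, K k * X * (K k)ᴴ) (h1 : ∑ k, (K k)ᴴ * K k = 1)
    {ρ : MatC n} (hρ : ρ.PosSemidef) (hρtr : ρ.trace = 1) (hfix : E ρ = ρ)
    (huniq : ∀ X, E X = X → ∃ a : ℂ, X = a • ρ)
    {L : MatC n} {l : ℂ} (hl : star l * l = 1) (hL : heis K L = l • L) :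
    (Lᴴ * L * ρ = (ρ * (Lᴴ * L)).trace • ρ) ∧ ((ρ * (Lᴴ * L)).trace = 0 → L = 0) ∧
    (L * ρ * Lᴴ = (ρ * (Lᴴ * L)).trace • ρ) ∧ (E (L * ρ) = star l • (L * ρ)) := by
  have hLs : ∑ k, (K k)ᴴ * Lᴴ * K k = star l • Lᴴ := by
    rw [← heis_apply, heis_star, hL, Matrix.conjTranspose_smul]
  have hL' : ∑ k, (K k)ᴴ * L * K k = l • L := hL
  have hl' : l * star l = 1 := by rw [mul_comm]; exact hl
  have hD : heis K (Lᴴ * L) - Lᴴ * L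
      = ∑ k, (L * K k - l • (K k * L))ᴴ * (L * K k - l • (K k * L)) := by
    have e : ∀ k, (L * K k - l • (K k * L))ᴴ * (L * K k - l • (K k * L))
        = (K k)ᴴ * (Lᴴ * L) * K k - l • ((K k)ᴴ * Lᴴ * K k * L)
          - star l • (Lᴴ * ((K k)ᴴ * L * K k)) + Lᴴ * ((K k)ᴴ * K k) * L := by
      intro k
      simp only [Matrix.conjTranspose_sub, Matrix.conjTranspose_smul, Matrix.conjTranspose_mul,
        Matrix.sub_mul, Matrix.mul_sub, Matrix.smul_mul, Matrix.mul_smul, smul_sub, smul_smul, hl, hl',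
        Matrix.mul_assoc, one_smul]
      abel
    simp only [e, Finset.sum_add_distrib, Finset.sum_sub_distrib, ← Finset.smul_sum,
      ← Finset.sum_mul, ← Finset.mul_sum, hLs, hL', h1, ← heis_apply]
    simp only [Matrix.smul_mul, Matrix.mul_smul, smul_smul, hl, hl', one_smul, Matrix.mul_one]
    abel
  have hsub : (heis K (Lᴴ * L) - Lᴴ * L).PosSemidef := by
    rw [hD]
    exact Matrix.posSemidef_sum _ fun k _ => Matrix.posSemidef_conjTranspose_mul_self _
  have hX : (Lᴴ * L).IsHermitian := Matrix.isHermitian_conjTranspose_mul_self L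
  have hle := subharmonic hK h1 hρ hρtr huniq hX hsub
  set c := (ρ * (Lᴴ * L)).trace with hc
  have hb : Lᴴ * L * ρ = c • ρ := by
    have := psd_trace_zero' hρ hle (by simp [Matrix.mul_sub, hρtr, ← hc])
    rw [Matrix.sub_mul, Matrix.smul_mul, Matrix.one_mul, sub_eq_zero] at this
    exact this.symm
  have hk : ∀ k, (L * K k - l • (K k * L)) * ρ = 0 := by
    have h0 : (ρ * (heis K (Lᴴ * L) - Lᴴ * L)).trace = 0 := by
      rw [Matrix.mul_sub, Matrix.trace_sub, Matrix.trace_mul_comm, heis_trace hK, hfix,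
        Matrix.trace_mul_comm, sub_self]
    rw [hD, Finset.mul_sum, Matrix.trace_sum] at h0
    have h2 : ∀ k, (ρ * ((L * K k - l • (K k * L))ᴴ * (L * K k - l • (K k * L)))).trace
        = ((L * K k - l • (K k * L)) * ρ * (L * K k - l • (K k * L))ᴴ).trace := by
      intro k
      rw [← Matrix.mul_assoc, Matrix.trace_mul_comm, Matrix.mul_assoc]
    simp only [h2] at h0
    rw [Finset.sum_eq_zero_iff_of_nonneg
      (fun k _ => (hρ.mul_mul_conjTranspose_same (L * K k - l • (K k * L))).trace_nonneg)] at h0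
    exact fun k => psd_trace_zero hρ (h0 k (Finset.mem_univ k))
  have hk' : ∀ k, K k * L * ρ = star l • (L * K k * ρ) := by
    intro k
    have := hk k
    rw [Matrix.sub_mul, sub_eq_zero] at this
    rw [this, Matrix.smul_mul, smul_smul, hl, one_smul]
  have hk'' : ∀ k, ρ * Lᴴ * (K k)ᴴ = l • (ρ * (K k)ᴴ * Lᴴ) := by
    intro k
    have := congrArg Matrix.conjTranspose (hk' k)
    simpa [hρ.1.eq, Matrix.mul_assoc] using this
  refine ⟨hb, ?_, ?_, ?_⟩
  · intro h0
    rw [h0, zero_smul, zero_sub] at hle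
    have h3 : (Lᴴ * L).trace ≤ 0 := by
      have := hle.trace_nonneg
      rw [Matrix.trace_neg] at this
      exact neg_nonneg.mp this
    have h4 := (Matrix.posSemidef_conjTranspose_mul_self L).trace_nonneg
    exact Matrix.trace_conjTranspose_mul_self_eq_zero_iff.mp (le_antisymm h3 h4)
  · have hF : E (L * ρ * Lᴴ) = L * ρ * Lᴴ := by
      conv_rhs => rw [← hfix]
      rw [hK, hK, Finset.mul_sum, Finset.sum_mul]
      refine Finset.sum_congr rfl fun k _ => ?_
      calc K k * (L * ρ * Lᴴ) * (K k)ᴴ = (K k * L * ρ) * Lᴴ * (K k)ᴴ := by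
            simp only [Matrix.mul_assoc]
        _ = star l • (L * K k * (ρ * Lᴴ * (K k)ᴴ)) := by
            rw [hk']; simp only [Matrix.mul_assoc, Matrix.smul_mul]
        _ = _ := by
            rw [hk'', Matrix.mul_smul, smul_smul, hl, one_smul]; simp only [Matrix.mul_assoc]
    obtain ⟨a, ha⟩ := huniq _ hF
    have : c = a := by
      have h5 := congrArg Matrix.trace ha
      rw [Matrix.trace_smul, hρtr, smul_eq_mul, mul_one] at h5
      rw [← h5, hc, ← Matrix.mul_assoc, Matrix.trace_mul_comm, Matrix.mul_assoc]
    rw [this, ha]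
  · conv_rhs => rw [← hfix]
    rw [hK, hK, Finset.mul_sum, Finset.smul_sum]
    refine Finset.sum_congr rfl fun k _ => ?_
    rw [← Matrix.mul_assoc, hk', Matrix.smul_mul]
    simp only [Matrix.mul_assoc]

lemma eig_nondeg {n : ℕ} {κ : Type} [Fintype κ] {K : κ → MatC n} {E : MatC n →ₗ[ℂ] MatC n}
    (hK : ∀ X, E X = ∑ k, K k * X * (K k)ᴴ) (h1 : ∑ k, (K k)ᴴ * K k = 1)
    {ρ : MatC n} (hρ : ρ.PosSemidef) (hρtr : ρ.trace = 1) (hfix : E ρ = ρ)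
    (huniq : ∀ X, E X = X → ∃ a : ℂ, X = a • ρ)
    {L M : MatC n} {l : ℂ} (hl : star l * l = 1) (hL : heis K L = l • L) (hL0 : L ≠ 0)
    (hM : heis K M = l • M) : ∃ a : ℂ, M = a • L := by
  have key : ∀ M, heis K M = l • M → (ρ * (Lᴴ * M)).trace = 0 → M = 0 := by
    intro M hM h0
    have h0' : (ρ * (Mᴴ * L)).trace = 0 := by
      have := congrArg star h0
      rw [← Matrix.trace_conjTranspose, star_zero, Matrix.conjTranspose_mul, hρ.1.eq,
        Matrix.trace_mul_comm] at this
      simpa using this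
    have bL := (eig_facts hK h1 hρ hρtr hfix huniq hl hL).1
    obtain ⟨bM, zM, dM, -⟩ := eig_facts hK h1 hρ hρtr hfix huniq hl hM
    have b1 := (eig_facts hK h1 hρ hρtr hfix huniq hl
      (show heis K (L + M) = l • (L + M) by rw [map_add, hL, hM, smul_add])).1
    have b2 := (eig_facts hK h1 hρ hρtr hfix huniq hl
      (show heis K (L + Complex.I • M) = l • (L + Complex.I • M) by
        rw [map_add, hL, _root_.map_smul, hM, smul_add, smul_comm])).1
    simp only [Matrix.conjTranspose_add, Matrix.conjTranspose_smul, Matrix.add_mul, Matrix.mul_add,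
      Matrix.smul_mul, Matrix.mul_smul, Matrix.trace_add, Matrix.trace_smul, h0, h0', bL, bM,
      smul_zero, add_zero, zero_add, smul_smul, add_smul] at b1 b2
    have e1 : Lᴴ * M * ρ + Mᴴ * L * ρ = 0 := by
      linear_combination (norm := module) b1
    have e2 : Complex.I • (Lᴴ * M * ρ) - Complex.I • (Mᴴ * L * ρ) = 0 := by
      simp at b2
      have hI : (Complex.I * (Complex.I * (ρ * (Mᴴ * M)).trace)) • ρ
          = -((ρ * (Mᴴ * M)).trace • ρ) := by
        rw [← mul_assoc, Complex.I_mul_I, neg_one_mul, neg_smul]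
      linear_combination (norm := module) b2 + hI
    have e3 : Lᴴ * M * ρ = 0 := by
      rw [← smul_sub, smul_eq_zero] at e2
      have e4 := e2.resolve_left Complex.I_ne_zero
      have : (2 : ℂ) • (Lᴴ * M * ρ) = 0 := by
        rw [two_smul]
        linear_combination (norm := module) e1 + e4
      exact (smul_eq_zero.mp this).resolve_left two_ne_zero
    have hLs : heis K Lᴴ = star l • Lᴴ := by
      rw [heis_star, hL, Matrix.conjTranspose_smul]
    obtain ⟨bs, zs, -, -⟩ := eig_facts hK h1 hρ hρtr hfix huniq
      (show star (star l) * star l = 1 by rw [star_star, mul_comm]; exact hl) hLs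
    rw [Matrix.conjTranspose_conjTranspose] at bs zs
    have e5 : (ρ * (Mᴴ * M)).trace • ((ρ * (L * Lᴴ)).trace • ρ) = 0 := by
      rw [← bs, Matrix.mul_assoc, ← Matrix.mul_smul, ← Matrix.mul_smul, ← dM, ← Matrix.mul_assoc Lᴴ,
        ← Matrix.mul_assoc Lᴴ, e3, Matrix.zero_mul, Matrix.mul_zero]
    have hρ0 : ρ ≠ 0 := by rintro rfl; simp at hρtr
    rcases smul_eq_zero.mp e5 with h | h
    · exact zM h
    · rcases smul_eq_zero.mp h with h | h
      · exact absurd (Matrix.conjTranspose_eq_zero.mp (zs h)) hL0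
      · exact absurd h hρ0
  have hc : (ρ * (Lᴴ * L)).trace ≠ 0 := fun h => hL0 (key L hL h)
  refine ⟨(ρ * (Lᴴ * M)).trace / (ρ * (Lᴴ * L)).trace, ?_⟩
  rw [← sub_eq_zero]
  apply key
  · rw [map_sub, _root_.map_smul, hL, hM, smul_sub, smul_comm]
  · simp only [Matrix.mul_sub, Matrix.mul_smul, Matrix.trace_sub, Matrix.trace_smul, smul_eq_mul]
    field_simp
    ring

lemma spectral_formula {n : ℕ} {E P : MatC n →ₗ[ℂ] MatC n} (hE : IsQuantumChannel E)
    (hErg : IsErgodic E) {ρ : MatC n} (hρ : ρ.PosSemidef) (hρtr : ρ.trace = 1) (hfix : E ρ = ρ)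
    {μ : ℂ} (hμ : Module.End.HasEigenvalue E μ) (hn : ‖μ‖ = 1)
    (hP : IsSpectralProjection E P μ) (X Y : MatC n) :
    P (X * P Y) = (ρ * X).trace • P Y ∧ P (P Y * X) = (ρ * X).trace • P Y := by
  obtain ⟨K, hK, h1⟩ := channel_kraus hE
  have hρ0 : ρ ≠ 0 := by rintro rfl; simp at hρtr
  have huniq : ∀ X, E X = X → ∃ a : ℂ, X = a • ρ := by
    intro X hX
    have hm : ∀ Z, E Z = Z → Z ∈ Module.End.eigenspace E 1 := by
      intro Z hZ
      rw [Module.End.mem_eigenspace_iff, one_smul, hZ]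
    obtain ⟨a, ha⟩ := (finrank_eq_one_iff_of_nonzero'
      (⟨ρ, hm ρ hfix⟩ : Module.End.eigenspace E 1) (by simpa using hρ0)).mp hErg ⟨X, hm X hX⟩
    exact ⟨a, (congrArg Subtype.val ha).symm⟩
  have hl : star μ * μ = 1 := by
    have := Complex.normSq_eq_conj_mul_self (z := μ)
    rw [Complex.normSq_eq_norm_sq, hn] at this
    simpa using this.symm
  have hl2 : star (star μ) * star μ = 1 := by rw [star_star, mul_comm]; exact hl
  set N : Module.End ℂ (MatC n) := E - μ • 1 with hNdef
  have hNapp : ∀ Z, N Z = E Z - μ • Z := fun Z => rfl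
  -- functionals vanishing on the range of `N` are left eigenvectors
  have hdual : ∀ Z : MatC n, (∀ W, (Z * N W).trace = 0) → heis K Z = μ • Z := by
    intro Z hZ
    rw [Matrix.ext_iff_trace_mul_right]
    intro W
    have := hZ W
    rw [hNapp, Matrix.mul_sub, Matrix.trace_sub, sub_eq_zero, ← heis_trace hK] at this
    rw [this]; simp
  obtain ⟨L, hL0, hL⟩ : ∃ L : MatC n, L ≠ 0 ∧ heis K L = μ • L := by
    have hns : LinearMap.range N < ⊤ := by
      rw [lt_top_iff_ne_top]
      intro htop
      obtain ⟨v, hv⟩ := hμ.exists_hasEigenvector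
      have hinj := LinearMap.injective_iff_surjective.mpr (LinearMap.range_eq_top.mp htop)
      apply hv.2
      apply hinj
      rw [map_zero, hNapp, hv.apply_eq_smul, sub_self]
    obtain ⟨f, hf, hle⟩ := Submodule.exists_le_ker_of_lt_top _ hns
    obtain ⟨Z, hZ⟩ := dual_eq_trace f
    refine ⟨Z, ?_, hdual Z fun W => ?_⟩
    · rintro rfl
      apply hf
      ext1 W
      simp [hZ]
    · rw [← hZ]
      exact hle (LinearMap.mem_range_self N W)
  have hLs : heis K Lᴴ = star μ • Lᴴ := by
    rw [heis_star, hL, Matrix.conjTranspose_smul]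
  obtain ⟨hb, hz, hd, he⟩ := eig_facts hK h1 hρ hρtr hfix huniq hl2 hLs
  rw [Matrix.conjTranspose_conjTranspose] at hb hz hd
  rw [star_star] at he
  set c := (ρ * (L * Lᴴ)).trace with hcdef
  have hc : c ≠ 0 := fun h => hL0 (Matrix.conjTranspose_eq_zero.mp (hz h))
  set R := Lᴴ * ρ with hR
  have hLR : (L * R).trace = c := by
    rw [hR, ← Matrix.mul_assoc, Matrix.trace_mul_comm]
  have hNR : N R = 0 := by rw [hNapp, he, sub_self]
  have hLN : ∀ (ν : ℂ) W, (L * (E W - ν • W)).trace = (μ - ν) * (L * W).trace := by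
    intro ν W
    rw [Matrix.mul_sub, Matrix.trace_sub, ← heis_trace hK, hL]
    simp [sub_mul]
  have hrange : ∀ W : MatC n, (L * W).trace = 0 → ∃ Z, (L * Z).trace = 0 ∧ N Z = W := by
    intro W hW
    have hmem : W ∈ LinearMap.range N := by
      by_contra hn
      obtain ⟨f, hf, hle⟩ := Submodule.exists_le_ker_of_notMem hn
      obtain ⟨Z, hZ⟩ := dual_eq_trace f
      obtain ⟨a, rfl⟩ := eig_nondeg hK h1 hρ hρtr hfix huniq hl hL hL0
        (hdual Z fun V => by rw [← hZ]; exact hle (LinearMap.mem_range_self N V))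
      apply hf
      rw [hZ, Matrix.smul_mul, Matrix.trace_smul, hW, smul_zero]
    obtain ⟨Z, rfl⟩ := hmem
    refine ⟨Z - ((L * Z).trace / c) • R, ?_, ?_⟩
    · rw [Matrix.mul_sub, Matrix.trace_sub, Matrix.mul_smul, Matrix.trace_smul, hLR, smul_eq_mul,
        div_mul_cancel₀ _ hc, sub_self]
    · rw [map_sub, _root_.map_smul, hNR, smul_zero, sub_zero]
  have hrangej : ∀ (j : ℕ) (W : MatC n), (L * W).trace = 0 → ∃ Z, (N ^ j) Z = W := by
    intro j
    induction j with
    | zero => exact fun W _ => ⟨W, rfl⟩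
    | succ j ih =>
      intro W hW
      obtain ⟨Z, hZ, rfl⟩ := hrange W hW
      obtain ⟨V, rfl⟩ := ih Z hZ
      exact ⟨V, by rw [pow_succ', Module.End.mul_apply]⟩
  have hgen : ∀ W ∈ Module.End.maxGenEigenspace E μ, (L * W).trace = 0 → W = 0 := by
    intro W hWm hW
    have hfin : ∀ V ∈ Module.End.maxGenEigenspace E μ,
        (N ^ (Module.finrank ℂ (MatC n))) V = 0 := by
      intro V hV
      rw [Module.End.maxGenEigenspace_eq_genEigenspace_finrank,
        Module.End.mem_genEigenspace_nat] at hV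
      exact hV
    obtain ⟨Z, hZ⟩ := hrangej (Module.finrank ℂ (MatC n)) W hW
    rw [← hZ]
    apply hfin
    rw [Module.End.mem_maxGenEigenspace]
    refine ⟨Module.finrank ℂ (MatC n) + Module.finrank ℂ (MatC n), ?_⟩
    rw [← hNdef, pow_add, Module.End.mul_apply, hZ]
    exact hfin W hWm
  have hRm : R ∈ Module.End.maxGenEigenspace E μ := by
    rw [Module.End.mem_maxGenEigenspace]
    exact ⟨1, by rw [pow_one]; exact hNR⟩
  have hker : ∀ W, P W = 0 → (L * W).trace = 0 := by
    intro W hW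
    let φ : MatC n →ₗ[ℂ] ℂ := (Matrix.traceLinearMap (Fin n) ℂ ℂ) ∘ₗ (LinearMap.mulLeft ℂ L)
    have hW' : W ∈ LinearMap.ker P := hW
    rw [hP.2.2] at hW'
    have hle : (⨆ ν ∈ {ν : ℂ | ν ≠ μ}, Module.End.maxGenEigenspace E ν) ≤ LinearMap.ker φ := by
      refine iSup₂_le fun ν hν V hV => ?_
      rw [Module.End.mem_maxGenEigenspace] at hV
      obtain ⟨k, hk⟩ := hV
      have hpow : ∀ (k : ℕ) V, (L * (((E - ν • 1 : Module.End ℂ (MatC n)) ^ k) V)).trace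
          = (μ - ν) ^ k * (L * V).trace := by
        intro k
        induction k with
        | zero => intro V; simp
        | succ k ih =>
          intro V
          rw [pow_succ', Module.End.mul_apply]
          refine (hLN ν _).trans ?_
          rw [ih, pow_succ']; ring
      have h6 := hpow k V
      rw [hk, Matrix.mul_zero, Matrix.trace_zero] at h6
      have h7 := (mul_eq_zero.mp h6.symm).resolve_left
        (pow_ne_zero k (sub_ne_zero.mpr (Ne.symm hν)))
      exact h7
    exact hle hW'
  have hform : ∀ W, P W = ((L * W).trace / c) • R := by
    intro W
    have hm : P W ∈ Module.End.maxGenEigenspace E μ := by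
      rw [← hP.2.1]; exact LinearMap.mem_range_self P W
    have hPP : P (P W) = P W := LinearMap.congr_fun hP.1 W
    have ht : (L * P W).trace = (L * W).trace := by
      have := hker (P W - W) (by rw [map_sub, hPP, sub_self])
      rwa [Matrix.mul_sub, Matrix.trace_sub, sub_eq_zero] at this
    rw [← sub_eq_zero]
    apply hgen
    · exact Submodule.sub_mem _ hm (Submodule.smul_mem _ _ hRm)
    · rw [Matrix.mul_sub, Matrix.trace_sub, ht, Matrix.mul_smul, Matrix.trace_smul, hLR,
        smul_eq_mul, div_mul_cancel₀ _ hc, sub_self]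
  have hXR : P (X * R) = (ρ * X).trace • R := by
    rw [hform]
    congr 1
    rw [div_eq_iff hc]
    calc (L * (X * R)).trace = (X * (Lᴴ * ρ * L)).trace := by
          rw [Matrix.trace_mul_comm, hR]; simp only [Matrix.mul_assoc]
      _ = _ := by
          rw [hd, Matrix.mul_smul, Matrix.trace_smul, Matrix.trace_mul_comm, smul_eq_mul, mul_comm]
  have hRX : P (R * X) = (ρ * X).trace • R := by
    rw [hform]
    congr 1
    rw [div_eq_iff hc]
    calc (L * (R * X)).trace = (L * Lᴴ * ρ * X).trace := by
          rw [hR]; simp only [Matrix.mul_assoc]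
      _ = _ := by
          rw [hb, Matrix.smul_mul, Matrix.trace_smul, smul_eq_mul, mul_comm]
  rw [hform Y, Matrix.mul_smul, Matrix.smul_mul, _root_.map_smul, _root_.map_smul, hXR, hRX]
  exact ⟨smul_comm _ _ _, smul_comm _ _ _⟩

/-- The `(i, j)` block of a bipartite operator. -/
def blk {d₁ d₂ : ℕ} (M : MatC2 d₁ d₂) (i j : Fin d₁) : MatC d₂ :=
  Matrix.of fun a b => M (i, a) (j, b)

lemma idTensor_apply' {d₁ d₂ : ℕ} (P : MatC d₂ →ₗ[ℂ] MatC d₂) (M : MatC2 d₁ d₂)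
    (i j : Fin d₁) (a b : Fin d₂) : idTensor P M (i, a) (j, b) = P (blk M i j) a b := rfl

lemma idTensor_kron {d₁ d₂ : ℕ} (P : MatC d₂ →ₗ[ℂ] MatC d₂) (A : MatC d₁) (B : MatC d₂) :
    idTensor P (A ⊗ₖ B) = A ⊗ₖ P B := by
  ext ⟨i, a⟩ ⟨j, b⟩
  have : blk (A ⊗ₖ B) i j = A i j • B := by
    ext a b; simp [blk, Matrix.kroneckerMap_apply]
  rw [idTensor_apply', this, _root_.map_smul]
  simp [Matrix.kroneckerMap_apply]

lemma blk_mul_left {d₁ d₂ : ℕ} (H : MatC2 d₁ d₂) (A : MatC d₁) (B : MatC d₂) (i j : Fin d₁) :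
    blk (H * (A ⊗ₖ B)) i j = ∑ k, A k j • (blk H i k * B) := by
  ext a b
  simp only [blk, Matrix.of_apply, Matrix.mul_apply, Matrix.kroneckerMap_apply,
    Fintype.sum_prod_type, Matrix.sum_apply, Matrix.smul_apply, smul_eq_mul, Finset.mul_sum]
  exact Finset.sum_congr rfl fun _ _ => Finset.sum_congr rfl fun _ _ => by ring

lemma blk_mul_right {d₁ d₂ : ℕ} (H : MatC2 d₁ d₂) (A : MatC d₁) (B : MatC d₂) (i j : Fin d₁) :
    blk ((A ⊗ₖ B) * H) i j = ∑ k, A i k • (B * blk H k j) := by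
  ext a b
  simp only [blk, Matrix.of_apply, Matrix.mul_apply, Matrix.kroneckerMap_apply,
    Fintype.sum_prod_type, Matrix.sum_apply, Matrix.smul_apply, smul_eq_mul, Finset.mul_sum]
  exact Finset.sum_congr rfl fun _ _ => Finset.sum_congr rfl fun _ _ => by ring

lemma ptr_apply {d₁ d₂ : ℕ} (H : MatC2 d₁ d₂) (ρ : MatC d₂) (i j : Fin d₁) :
    ptr₂ (((1 : MatC d₁) ⊗ₖ ρ) * H) i j = (ρ * blk H i j).trace := by
  change ∑ a, blk (((1 : MatC d₁) ⊗ₖ ρ) * H) i j a a = _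
  rw [blk_mul_right]
  simp [Matrix.one_apply, Matrix.trace]

end ZenoHelpers

/-- **Zeno Hamiltonian of bath dynamical decoupling with an ergodic channel.**
If `𝓔₂` is ergodic with unique fixed-point state `ρ*`, then for every Hamiltonian
`H = H†` and all product operators `A₁ ⊗ A₂`,
`Σ_{|λ_ℓ|=1} [(𝓘₁⊗P_ℓ) ∘ [H,·] ∘ (𝓘₁⊗P_ℓ)](A₁⊗A₂) = [tr₂((𝟙₁⊗ρ*)H), A₁] ⊗ P_φ(A₂)`. -/
theorem ergodic_zeno_hamiltonian_formula {d₁ d₂ : ℕ}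
    (E₂ : MatC d₂ →ₗ[ℂ] MatC d₂) (hE₂ : IsQuantumChannel E₂) (hErg : IsErgodic E₂)
    (ρstar : MatC d₂) (hρ : ρstar.PosSemidef) (hρtr : ρstar.trace = 1)
    (hfix : E₂ ρstar = ρstar)
    (S : Finset ℂ) (hS : ∀ μ : ℂ, μ ∈ S ↔ (Module.End.HasEigenvalue E₂ μ ∧ ‖μ‖ = 1))
    (P : ℂ → (MatC d₂ →ₗ[ℂ] MatC d₂)) (hP : ∀ μ ∈ S, IsSpectralProjection E₂ (P μ) μ)
    (H : MatC2 d₁ d₂) (hH : H.IsHermitian) :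
    ∀ (A₁ : MatC d₁) (A₂ : MatC d₂),
      ∑ μ ∈ S, idTensor (P μ)
          (H * idTensor (P μ) (A₁ ⊗ₖ A₂) - idTensor (P μ) (A₁ ⊗ₖ A₂) * H)
        = (ptr₂ (((1 : MatC d₁) ⊗ₖ ρstar) * H) * A₁
            - A₁ * ptr₂ (((1 : MatC d₁) ⊗ₖ ρstar) * H)) ⊗ₖ (∑ μ ∈ S, P μ) A₂ := by
  intro A₁ A₂
  rw [LinearMap.sum_apply]
  have hsum : ∀ (C : MatC d₁), C ⊗ₖ (∑ μ ∈ S, P μ A₂) = ∑ μ ∈ S, C ⊗ₖ (P μ A₂) := by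
    intro C
    ext ⟨i, a⟩ ⟨j, b⟩
    simp [Matrix.kroneckerMap_apply, Matrix.sum_apply, Finset.mul_sum]
  rw [hsum]
  refine Finset.sum_congr rfl fun μ hμ => ?_
  obtain ⟨hev, hn⟩ := (hS μ).mp hμ
  have key := fun X => spectral_formula hE₂ hErg hρ hρtr hfix hev hn (hP μ hμ) X A₂
  rw [idTensor_kron, map_sub]
  ext ⟨i, a⟩ ⟨j, b⟩
  rw [Matrix.sub_apply, idTensor_apply', idTensor_apply', blk_mul_left, blk_mul_right]
  simp only [map_sum, _root_.map_smul, (key _).1, (key _).2, Matrix.kroneckerMap_apply,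
    Matrix.sub_apply, Matrix.mul_apply, ptr_apply, Matrix.sum_apply, Matrix.smul_apply,
    smul_eq_mul, sub_mul, Finset.sum_mul]
  congr 1
  · exact Finset.sum_congr rfl fun _ _ => by ring
  · exact Finset.sum_congr rfl fun _ _ => by ring
end
end

section
/- Let 𝓔₂ : B(ℋ₂) → B(ℋ₂) be a quantum channel that is NOT ergodic, with peripheral spectral projections P_ℓ and peripheral projection P_φ = Σ_ℓ P_ℓ, and let ℋ₁ be a finite-dimensional Hilbert space with dim ℋ₁ ≥ 2. Then there exists a Hermitian operator H₂ ∈ B(ℋ₂) whose left multiplication does not act as a scalar on the space of recurrences X(𝓔₂), such that for all X ∈ X(𝓔₂) and all ℓ: H₂ P_ℓ(X) = P_ℓ(H₂ X), P_ℓ(X) H₂ = P_ℓ(X H₂), and [H₂, P_ℓ(X)] = P_ℓ([H₂, X]). Consequently, for every Hermitian H₁ ∈ B(ℋ₁), the coupling Hamiltonian H = H₁ ⊗ H₂ satisfies (𝓘₁⊗P_ℓ) ∘ [H,·] ∘ (𝓘₁⊗P_ℓ) = [H,·] ∘ (𝓘₁⊗P_ℓ) for every ℓ, so that the Zeno Hamiltonian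 with respect to 𝓘₁⊗𝓔₂ equals Σ_ℓ (𝓘₁⊗P_ℓ)[H,·](𝓘₁⊗P_ℓ) = [H,·] ∘ (𝓘₁⊗P_φ), i.e. the interaction H₁⊗H₂ survives the Zeno projection. -/
open Matrix Kronecker
open scoped ComplexOrder
noncomputable section

/-- The space of recurrences: the span of all peripheral eigenoperators. -/
def recSpace {n : ℕ} (E : MatC n →ₗ[ℂ] MatC n) : Submodule ℂ (MatC n) :=
  ⨆ μ ∈ {μ : ℂ | ‖μ‖ = 1}, Module.End.eigenspace E μ


open scoped MatrixOrder Matrix.Norms.L2Operator in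
lemma psd_sqrt {m : Type*} [Fintype m] [DecidableEq m] {M : Matrix m m ℂ} (h : M.PosSemidef) :
    ∃ B : Matrix m m ℂ, M = Bᴴ * B :=
  CStarAlgebra.nonneg_iff_eq_star_mul_self.1 h.nonneg


lemma exists_kraus {n : ℕ} (E : MatC n →ₗ[ℂ] MatC n) (h : (choi E).PosSemidef) :
    ∃ K : (Fin n × Fin n) → MatC n, ∀ X, E X = ∑ i, K i * X * (K i)ᴴ := by
  obtain ⟨B, hB⟩ := psd_sqrt h
  refine ⟨fun i => Matrix.of fun a b => star (B i (a, b)), fun X => ?_⟩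
  have key : ∀ a b, E (Matrix.single a b 1) =
      ∑ i, (Matrix.of fun a b => star (B i (a, b)) : MatC n) * Matrix.single a b 1 *
        (Matrix.of fun a b => star (B i (a, b)) : MatC n)ᴴ := by
    intro a b
    ext p q
    have := congrFun (congrFun hB (p, a)) (q, b)
    simp only [choi] at this
    rw [this]
    simp [Matrix.mul_apply, Matrix.sum_apply, Matrix.single_apply, Finset.sum_ite_eq, ite_and]
  let F : MatC n →ₗ[ℂ] MatC n := ∑ i, (LinearMap.mulRight ℂ ((Matrix.of fun a b => star (B i (a, b)) : MatC n)ᴴ)) ∘ₗ LinearMap.mulLeft ℂ (Matrix.of fun a b => star (B i (a, b)) : MatC n)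
  have hF : ∀ X, F X = ∑ i, (Matrix.of fun a b => star (B i (a, b)) : MatC n) * X *
        (Matrix.of fun a b => star (B i (a, b)) : MatC n)ᴴ := by
    intro X; simp [F]
  rw [← hF]
  congr 1
  apply Matrix.ext_linearMap
  intro i j
  ext1
  simp [hF, key]

/-- domination of a sesquilinear form -/
def Dom {n : ℕ} (X A : MatC n) : Prop :=
  ∀ u v : Fin n → ℂ, 2 * ‖star u ⬝ᵥ X *ᵥ v‖ ≤ (star u ⬝ᵥ A *ᵥ u).re + (star v ⬝ᵥ A *ᵥ v).re

lemma form_kraus {n : ℕ} {ι : Type*} [Fintype ι] (K : ι → MatC n) (X : MatC n) (u v : Fin n → ℂ) :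
    star u ⬝ᵥ (∑ i, K i * X * (K i)ᴴ) *ᵥ v =
      ∑ i, star ((K i)ᴴ *ᵥ u) ⬝ᵥ X *ᵥ ((K i)ᴴ *ᵥ v) := by
  rw [Matrix.sum_mulVec, dotProduct_sum]
  refine Finset.sum_congr rfl fun i _ => ?_
  rw [Matrix.star_mulVec, conjTranspose_conjTranspose, Matrix.mulVec_mulVec,
    ← Matrix.dotProduct_mulVec, Matrix.mulVec_mulVec, Matrix.mul_assoc]

lemma Dom.map {n : ℕ} {ι : Type*} [Fintype ι] (K : ι → MatC n) {X A : MatC n} (h : Dom X A) :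
    Dom (∑ i, K i * X * (K i)ᴴ) (∑ i, K i * A * (K i)ᴴ) := by
  intro u v
  rw [form_kraus, form_kraus, form_kraus, Complex.re_sum, Complex.re_sum, ← Finset.sum_add_distrib]
  calc _ ≤ 2 * ∑ i, ‖star ((K i)ᴴ *ᵥ u) ⬝ᵥ X *ᵥ ((K i)ᴴ *ᵥ v)‖ := by
        gcongr; exact norm_sum_le _ _
    _ = ∑ i, 2 * ‖star ((K i)ᴴ *ᵥ u) ⬝ᵥ X *ᵥ ((K i)ᴴ *ᵥ v)‖ := Finset.mul_sum _ _ _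
    _ ≤ _ := Finset.sum_le_sum fun i _ => h _ _

lemma exists_dom {n : ℕ} (X : MatC n) : ∃ c : ℝ, 0 ≤ c ∧ Dom X ((c : ℂ) • (1 : MatC n)) := by
  refine ⟨∑ i, ∑ j, ‖X i j‖, by positivity, fun u v => ?_⟩
  have hself : ∀ w : Fin n → ℂ, (star w ⬝ᵥ w).re = ∑ i, ‖w i‖ ^ 2 := by
    intro w
    simp only [dotProduct, Complex.re_sum, Pi.star_apply]
    refine Finset.sum_congr rfl fun i _ => ?_
    rw [Complex.star_def, ← Complex.normSq_eq_conj_mul_self, Complex.ofReal_re, Complex.normSq_eq_norm_sq]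
  simp only [Matrix.smul_mulVec, Matrix.one_mulVec, dotProduct_smul, smul_eq_mul,
    Complex.re_ofReal_mul, hself]
  have h1 : ‖star u ⬝ᵥ X *ᵥ v‖ ≤ ∑ i, ∑ j, ‖u i‖ * (‖X i j‖ * ‖v j‖) := by
    simp only [dotProduct, mulVec, Finset.mul_sum, Pi.star_apply]
    refine (norm_sum_le _ _).trans (Finset.sum_le_sum fun i _ => ?_)
    refine (norm_sum_le _ _).trans (Finset.sum_le_sum fun j _ => ?_)
    simp
  have hle : ∀ (w : Fin n → ℂ) i, ‖w i‖ ^ 2 ≤ ∑ i, ‖w i‖ ^ 2 := fun w i =>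
    Finset.single_le_sum (f := fun i => ‖w i‖ ^ 2) (fun i _ => by positivity) (Finset.mem_univ i)
  calc _ ≤ 2 * ∑ i, ∑ j, ‖u i‖ * (‖X i j‖ * ‖v j‖) := by gcongr
    _ = ∑ i, ∑ j, ‖X i j‖ * (2 * (‖u i‖ * ‖v j‖)) := by
        rw [Finset.mul_sum]; refine Finset.sum_congr rfl fun i _ => ?_
        rw [Finset.mul_sum]; refine Finset.sum_congr rfl fun j _ => ?_
        ring
    _ ≤ ∑ i, ∑ j, ‖X i j‖ * (∑ i, ‖u i‖ ^ 2 + ∑ i, ‖v i‖ ^ 2) := by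
        gcongr with i _ j _
        nlinarith [sq_nonneg (‖u i‖ - ‖v j‖), hle u i, hle v j]
    _ = _ := by simp only [← Finset.sum_mul]; ring

lemma Dom.zero_left {n : ℕ} {X A : MatC n} (h : Dom X A) {u : Fin n → ℂ} (hu : A *ᵥ u = 0)
    (v : Fin n → ℂ) : star u ⬝ᵥ X *ᵥ v = 0 := by
  by_contra hne
  have hpos : 0 < ‖star u ⬝ᵥ X *ᵥ v‖ := norm_pos_iff.2 hne
  obtain ⟨t, ht⟩ := exists_nat_gt ((star v ⬝ᵥ A *ᵥ v).re / ‖star u ⬝ᵥ X *ᵥ v‖)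
  rw [div_lt_iff₀ hpos] at ht
  have := h ((t : ℂ) • u) v
  rw [Matrix.mulVec_smul, hu, star_smul, smul_dotProduct] at this
  simp at this
  nlinarith [Nat.cast_nonneg (α := ℝ) t]

lemma Dom.zero_right {n : ℕ} {X A : MatC n} (h : Dom X A) {v : Fin n → ℂ} (hv : A *ᵥ v = 0)
    (u : Fin n → ℂ) : star u ⬝ᵥ X *ᵥ v = 0 := by
  by_contra hne
  have hpos : 0 < ‖star u ⬝ᵥ X *ᵥ v‖ := norm_pos_iff.2 hne
  obtain ⟨t, ht⟩ := exists_nat_gt ((star u ⬝ᵥ A *ᵥ u).re / ‖star u ⬝ᵥ X *ᵥ v‖)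
  rw [div_lt_iff₀ hpos] at ht
  have := h u ((t : ℂ) • v)
  rw [Matrix.mulVec_smul, Matrix.mulVec_smul, hv, dotProduct_smul] at this
  simp at this
  nlinarith [Nat.cast_nonneg (α := ℝ) t]

lemma Dom.mul_zero_left {n : ℕ} {X A L : MatC n} (h : Dom X A) (hL : A * Lᴴ = 0) : L * X = 0 := by
  ext i j
  have := h.zero_left (u := Lᴴ *ᵥ Pi.single i 1) (by rw [Matrix.mulVec_mulVec, hL, Matrix.zero_mulVec])
    (Pi.single j 1)
  rw [Matrix.star_mulVec, conjTranspose_conjTranspose, ← Matrix.dotProduct_mulVec,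
    Matrix.mulVec_mulVec] at this
  simpa using this

lemma Dom.mul_zero_right {n : ℕ} {X A L : MatC n} (h : Dom X A) (hL : A * Lᴴ = 0) : X * Lᴴ = 0 := by
  ext i j
  have := h.zero_right (v := Lᴴ *ᵥ Pi.single j 1) (by rw [Matrix.mulVec_mulVec, hL, Matrix.zero_mulVec])
    (Pi.single i 1)
  rw [Matrix.mulVec_mulVec] at this
  simpa using this

lemma Dom.entry {n : ℕ} {X A : MatC n} (h : Dom X A) (i j : Fin n) :
    2 * ‖X i j‖ ≤ (A i i).re + (A j j).re := by
  have := h (Pi.single i 1) (Pi.single j 1)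
  simpa using this

lemma Dom.diag_le {n : ℕ} {X A : MatC n} (h : Dom X A) (i : Fin n) : (A i i).re ≤ A.trace.re := by
  rw [Matrix.trace, Complex.re_sum]
  refine Finset.single_le_sum (f := fun i => (A i i).re) (fun i _ => ?_) (Finset.mem_univ i)
  have := h.entry i i
  have := norm_nonneg (X i i)
  linarith

lemma Dom.entry_le {n : ℕ} {X A : MatC n} (h : Dom X A) (i j : Fin n) : ‖X i j‖ ≤ A.trace.re := by
  have := h.entry i j
  have := h.diag_le i
  have := h.diag_le j
  linarith

/-! ### Bounded powers -/

lemma dom_pow {n : ℕ} (E : MatC n →ₗ[ℂ] MatC n) (h : (choi E).PosSemidef) {X A : MatC n}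
    (hD : Dom X A) (k : ℕ) : Dom ((E ^ k) X) ((E ^ k) A) := by
  obtain ⟨K, hK⟩ := exists_kraus E h
  induction k with
  | zero => simpa using hD
  | succ k ih =>
    rw [pow_succ', Module.End.mul_apply, Module.End.mul_apply, hK, hK]
    exact ih.map K

lemma trace_pow {n : ℕ} (E : MatC n →ₗ[ℂ] MatC n) (h : ∀ A, (E A).trace = A.trace) (A : MatC n)
    (k : ℕ) : ((E ^ k) A).trace = A.trace := by
  induction k with
  | zero => simp
  | succ k ih => rw [pow_succ', Module.End.mul_apply, h, ih]

lemma bounded_pow {n : ℕ} (E : MatC n →ₗ[ℂ] MatC n) (h : IsQuantumChannel E) (X : MatC n) :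
    ∃ C : ℝ, ∀ k i j, ‖(E ^ k) X i j‖ ≤ C := by
  obtain ⟨c, hc, hD⟩ := exists_dom X
  refine ⟨(((c : ℂ) • (1 : MatC n)).trace).re,
    fun k i j => ((dom_pow E h.1 hD k).entry_le i j).trans_eq ?_⟩
  rw [trace_pow E h.2]

lemma semisimple {n : ℕ} (E : MatC n →ₗ[ℂ] MatC n) (h : IsQuantumChannel E) {μ : ℂ} (hμ : ‖μ‖ = 1)
    (X Y : MatC n) (hX : E X = μ • X + Y) (hY : E Y = μ • Y) : Y = 0 := by
  obtain ⟨C, hC⟩ := bounded_pow E h X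
  have hp : ∀ k : ℕ, (E ^ (k + 1)) X = μ ^ (k + 1) • X + ((k + 1 : ℂ) * μ ^ k) • Y := by
    intro k
    induction k with
    | zero => simp [hX]
    | succ k ih =>
      rw [pow_succ', Module.End.mul_apply, ih, map_add, map_smul, map_smul, hX, hY]
      push_cast
      module
  ext i j
  by_contra hne
  have hpos : 0 < ‖Y i j‖ := norm_pos_iff.2 hne
  obtain ⟨k, hk⟩ := exists_nat_gt ((C + ‖X i j‖) / ‖Y i j‖)
  rw [div_lt_iff₀ hpos] at hk
  have h1 := hC (k + 1) i j
  have h2 : ((k + 1 : ℂ) * μ ^ k) * Y i j = (E ^ (k + 1)) X i j - μ ^ (k + 1) * X i j := by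
    rw [hp k]; simp
  have h3 : ‖((k + 1 : ℂ) * μ ^ k) * Y i j‖ = (k + 1) * ‖Y i j‖ := by
    rw [norm_mul, norm_mul, norm_pow, hμ]
    have : ‖(k + 1 : ℂ)‖ = k + 1 := by
      have := Complex.norm_natCast (k + 1)
      push_cast at this
      exact this
    rw [this]; simp
  have h4 := norm_sub_le ((E ^ (k + 1)) X i j) (μ ^ (k + 1) * X i j)
  rw [← h2, h3, norm_mul, norm_pow, hμ] at h4
  simp at h4
  nlinarith

lemma maxGen_eq {n : ℕ} (E : MatC n →ₗ[ℂ] MatC n) (h : IsQuantumChannel E) {μ : ℂ} (hμ : ‖μ‖ = 1)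
    {X : MatC n} (hX : X ∈ Module.End.maxGenEigenspace E μ) : E X = μ • X := by
  obtain ⟨k, hk⟩ := (Module.End.mem_maxGenEigenspace _ _ _).1 hX
  clear hX
  induction k generalizing X with
  | zero => simp at hk; simp [hk]
  | succ k ih =>
    rw [pow_succ, Module.End.mul_apply] at hk
    have h1 := ih hk
    have := semisimple E h hμ X _ (by simp) h1
    simp at this
    exact sub_eq_zero.1 this

/-! ### The maximal invariant state -/

lemma exists_decomp {n : ℕ} (E : MatC n →ₗ[ℂ] MatC n) (h : IsQuantumChannel E) (X : MatC n) :
    ∃ f g : MatC n, E f = f ∧ X = f + (E g - g) := by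
  have hdis : Disjoint (LinearMap.ker (E - 1)) (LinearMap.range (E - 1)) := by
    rw [Submodule.disjoint_def]
    rintro Y hY ⟨g, rfl⟩
    refine semisimple E h (μ := 1) (by simp) g _ (by simp) ?_
    have : E ((E - 1) g) - (E - 1) g = 0 := hY
    rw [one_smul]
    exact sub_eq_zero.1 this
  have htop := Submodule.eq_top_of_disjoint _ _
    (by rw [add_comm]; exact (LinearMap.finrank_range_add_finrank_ker (E - 1)).ge) hdis
  obtain ⟨f, hf, y, ⟨g, rfl⟩, hfg⟩ := Submodule.mem_sup.1 (htop.symm ▸ Submodule.mem_top : X ∈ _)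
  refine ⟨f, g, ?_, ?_⟩
  · have : E f - f = 0 := hf
    exact sub_eq_zero.1 this
  · rw [← hfg]; rfl

lemma psd_pow {n : ℕ} (E : MatC n →ₗ[ℂ] MatC n) (h : (choi E).PosSemidef) (k : ℕ) :
    ((E ^ k) 1).PosSemidef := by
  obtain ⟨K, hK⟩ := exists_kraus E h
  induction k with
  | zero => simpa using Matrix.PosSemidef.one
  | succ k ih =>
    rw [pow_succ', Module.End.mul_apply, hK]
    exact Matrix.posSemidef_sum _ fun i _ => ih.mul_mul_conjTranspose_same _

/-- ergodic averages of the identity -/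
def avg {n : ℕ} (E : MatC n →ₗ[ℂ] MatC n) (N : ℕ) : MatC n :=
  ((N + 1 : ℝ)⁻¹ : ℝ) • ∑ k ∈ Finset.range (N + 1), (E ^ k) 1

lemma avg_psd {n : ℕ} (E : MatC n →ₗ[ℂ] MatC n) (h : (choi E).PosSemidef) (N : ℕ) :
    (avg E N).PosSemidef := by
  unfold avg
  refine Matrix.PosSemidef.smul (Matrix.posSemidef_sum _ fun i _ => psd_pow E h i) (by positivity)

lemma avg_eq {n : ℕ} (E : MatC n →ₗ[ℂ] MatC n) {f g : MatC n} (hf : E f = f)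
    (h1 : (1 : MatC n) = f + (E g - g)) (N : ℕ) :
    avg E N = f + ((N + 1 : ℝ)⁻¹ : ℝ) • ((E ^ (N + 1)) g - g) := by
  have hfk : ∀ k, (E ^ k) f = f := by
    intro k
    induction k with
    | zero => simp
    | succ k ih => rw [pow_succ', Module.End.mul_apply, ih, hf]
  have : ∀ M : ℕ, ∑ k ∈ Finset.range M, (E ^ k) 1 = (M : ℝ) • f + ((E ^ M) g - g) := by
    intro M
    induction M with
    | zero => simp
    | succ M ih =>
      rw [Finset.sum_range_succ, ih, h1, map_add, map_sub, hfk, ← Module.End.mul_apply, ← pow_succ]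
      push_cast
      module
  have hN : (N + 1 : ℝ) ≠ 0 := by positivity
  rw [avg, this]
  push_cast
  rw [smul_add, smul_smul, inv_mul_cancel₀ hN, one_smul]

lemma avg_tendsto {n : ℕ} (E : MatC n →ₗ[ℂ] MatC n) (h : IsQuantumChannel E) {f g : MatC n}
    (hf : E f = f) (h1 : (1 : MatC n) = f + (E g - g)) :
    Filter.Tendsto (avg E) Filter.atTop (nhds f) := by
  obtain ⟨C, hC⟩ := bounded_pow E h g
  refine tendsto_pi_nhds.2 fun i => tendsto_pi_nhds.2 fun j => ?_
  have h0 : Filter.Tendsto (fun N : ℕ => ((N + 1 : ℝ)⁻¹ : ℝ) * (C + ‖g i j‖)) Filter.atTop (nhds 0) := by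
    have := (tendsto_one_div_add_atTop_nhds_zero_nat (𝕜 := ℝ)).mul_const (C + ‖g i j‖)
    simpa using this
  refine tendsto_iff_norm_sub_tendsto_zero.2 (squeeze_zero (fun _ => norm_nonneg _) (fun N => ?_) h0)
  rw [avg_eq E hf h1]
  simp only [Matrix.add_apply, Matrix.smul_apply, add_sub_cancel_left, norm_smul]
  rw [Real.norm_of_nonneg (by positivity)]
  gcongr
  exact (norm_sub_le _ _).trans (by gcongr; exact hC _ _ _)

lemma Dom.avg {n : ℕ} {X : MatC n} {B : ℕ → MatC n} (h : ∀ k, Dom X (B k)) (N : ℕ) :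
    Dom X (((N + 1 : ℝ)⁻¹ : ℝ) • ∑ k ∈ Finset.range (N + 1), B k) := by
  intro u v
  have hs : ∀ w : Fin n → ℂ, (star w ⬝ᵥ (((N + 1 : ℝ)⁻¹ : ℝ) • ∑ k ∈ Finset.range (N + 1), B k) *ᵥ w).re
      = (N + 1 : ℝ)⁻¹ * ∑ k ∈ Finset.range (N + 1), (star w ⬝ᵥ B k *ᵥ w).re := by
    intro w
    rw [Matrix.smul_mulVec, Matrix.sum_mulVec, dotProduct_smul, dotProduct_sum, Complex.smul_re,
      Complex.re_sum, smul_eq_mul]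
  rw [hs, hs, ← mul_add, ← Finset.sum_add_distrib, inv_mul_eq_div, le_div_iff₀ (by positivity)]
  calc _ = ∑ k ∈ Finset.range (N + 1), 2 * ‖star u ⬝ᵥ X *ᵥ v‖ := by
        simp; ring
    _ ≤ _ := Finset.sum_le_sum fun k _ => h k u v

lemma exists_max {n : ℕ} (E : MatC n →ₗ[ℂ] MatC n) (h : IsQuantumChannel E) :
    ∃ f : MatC n, f.PosSemidef ∧ E f = f ∧
      ∀ μ : ℂ, ‖μ‖ = 1 → ∀ X, E X = μ • X → ∃ c : ℂ, Dom X (c • f) := by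
  obtain ⟨f, g, hf, h1⟩ := exists_decomp E h 1
  have hlim := avg_tendsto E h hf h1
  refine ⟨f, ?_, hf, ?_⟩
  · rw [Matrix.posSemidef_iff_dotProduct_mulVec]
    constructor
    · have h2 : Filter.Tendsto (fun N => (avg E N)ᴴ) Filter.atTop (nhds fᴴ) :=
        (continuous_id.matrix_conjTranspose.tendsto f).comp hlim
      have h3 : (fun N => (avg E N)ᴴ) = avg E := funext fun N => (avg_psd E h.1 N).1
      rw [h3] at h2
      exact tendsto_nhds_unique h2 hlim
    · intro x
      have hc : Continuous fun M : MatC n => star x ⬝ᵥ M *ᵥ x := by fun_prop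
      exact ge_of_tendsto' ((hc.tendsto f).comp hlim)
        fun N => (avg_psd E h.1 N).dotProduct_mulVec_nonneg x
  · intro μ hμ X hX
    obtain ⟨c, hc, hD⟩ := exists_dom X
    refine ⟨c, ?_⟩
    have hXk : ∀ k, (E ^ k) X = μ ^ k • X := by
      intro k
      induction k with
      | zero => simp
      | succ k ih => rw [pow_succ', Module.End.mul_apply, ih, map_smul, hX, smul_smul, pow_succ]
    have hDk : ∀ k, Dom X ((c : ℂ) • (E ^ k) 1) := by
      intro k u v
      have := dom_pow E h.1 hD k u v
      rw [hXk, map_smul, Matrix.smul_mulVec, dotProduct_smul, norm_smul, norm_pow, hμ, one_pow,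
        one_mul] at this
      exact this
    have hDa : ∀ N, Dom X ((c : ℂ) • avg E N) := by
      intro N
      have := Dom.avg hDk N
      rw [← Finset.smul_sum, smul_comm] at this
      exact this
    intro u v
    have hcont : Continuous fun M : MatC n => (star u ⬝ᵥ ((c : ℂ) • M) *ᵥ u).re +
        (star v ⬝ᵥ ((c : ℂ) • M) *ᵥ v).re := by fun_prop
    exact ge_of_tendsto' ((hcont.tendsto f).comp hlim) fun N => hDa N u v

/-! ### Fixed points of the dual map commute with the Kraus operators -/

lemma commute_kraus {n : ℕ} {ι : Type*} [Fintype ι] (E : MatC n →ₗ[ℂ] MatC n)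
    (K : ι → MatC n) (hK : ∀ X, E X = ∑ i, K i * X * (K i)ᴴ)
    (htr : ∀ A, (E A).trace = A.trace) {f Z : MatC n} (hf : f.PosSemidef) (hEf : E f = f)
    (hZ : Z.IsHermitian) (hZE : ∀ X, (Z * E X).trace = (Z * X).trace) (i : ι) :
    f * (K i * Z - Z * K i)ᴴ = 0 := by
  have hpsd : ∀ i, ((K i * Z - Z * K i) * f * (K i * Z - Z * K i)ᴴ).PosSemidef :=
    fun i => hf.mul_mul_conjTranspose_same _
  have hsum : ∑ i, ((K i * Z - Z * K i) * f * (K i * Z - Z * K i)ᴴ).trace = 0 := by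
    have e1 : ∀ i, ((K i * Z - Z * K i) * f * (K i * Z - Z * K i)ᴴ) =
        K i * (Z * f * Z) * (K i)ᴴ - (K i * (Z * f) * (K i)ᴴ) * Z
          - Z * (K i * (f * Z) * (K i)ᴴ) + Z * (K i * f * (K i)ᴴ) * Z := by
      intro i
      rw [conjTranspose_sub, conjTranspose_mul, conjTranspose_mul, hZ.eq]
      noncomm_ring
    rw [← Matrix.trace_sum]
    simp only [e1, Finset.sum_add_distrib, Finset.sum_sub_distrib, ← Finset.mul_sum,
      ← Finset.sum_mul, ← hK, Matrix.trace_add, Matrix.trace_sub, htr, hZE, hEf]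
    rw [Matrix.trace_mul_comm (E (Z * f)) Z, hZE, Matrix.mul_assoc Z f Z]
    rw [← Matrix.trace_mul_comm (f * Z) Z, ← Matrix.trace_mul_comm (Z * f) Z, Matrix.mul_assoc f Z Z,
      Matrix.mul_assoc Z f Z, ← Matrix.trace_mul_comm (f * Z) Z, Matrix.mul_assoc f Z Z]
    ring
  have h0 := (Finset.sum_eq_zero_iff_of_nonneg (fun i _ => (hpsd i).trace_nonneg)).1 hsum i
    (Finset.mem_univ i)
  obtain ⟨B, rfl⟩ := psd_sqrt hf
  have : ((K i * Z - Z * K i) * (Bᴴ * B) * (K i * Z - Z * K i)ᴴ) =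
      (B * (K i * Z - Z * K i)ᴴ)ᴴ * (B * (K i * Z - Z * K i)ᴴ) := by
    rw [conjTranspose_mul, conjTranspose_conjTranspose]; simp only [Matrix.mul_assoc]
  rw [this, Matrix.trace_conjTranspose_mul_self_eq_zero_iff] at h0
  rw [Matrix.mul_assoc, h0, Matrix.mul_zero]

lemma mul_intertwine {n : ℕ} (E : MatC n →ₗ[ℂ] MatC n) (h : IsQuantumChannel E) {Z : MatC n}
    (hZ : Z.IsHermitian) (hZE : ∀ X, (Z * E X).trace = (Z * X).trace) {μ : ℂ} (hμ : ‖μ‖ = 1)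
    {X : MatC n} (hX : E X = μ • X) : E (Z * X) = μ • (Z * X) ∧ E (X * Z) = μ • (X * Z) := by
  obtain ⟨K, hK⟩ := exists_kraus E h.1
  obtain ⟨f, hf, hEf, hmax⟩ := exists_max E h
  obtain ⟨c, hD⟩ := hmax μ hμ X hX
  have hL : ∀ i, (c • f) * (K i * Z - Z * K i)ᴴ = 0 := fun i => by
    rw [Matrix.smul_mul, commute_kraus E K hK h.2 hf hEf hZ hZE, smul_zero]
  constructor
  · rw [← Matrix.mul_smul, ← hX, hK, hK, Finset.mul_sum]
    refine Finset.sum_congr rfl fun i _ => ?_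
    have := hD.mul_zero_left (hL i)
    rw [Matrix.sub_mul, sub_eq_zero] at this
    rw [← Matrix.mul_assoc (K i), this]
    simp only [Matrix.mul_assoc]
  · rw [← Matrix.smul_mul, ← hX, hK, hK, Finset.sum_mul]
    refine Finset.sum_congr rfl fun i _ => ?_
    have := hD.mul_zero_right (hL i)
    rw [conjTranspose_sub, conjTranspose_mul, conjTranspose_mul, hZ.eq, Matrix.mul_sub,
      sub_eq_zero] at this
    rw [Matrix.mul_assoc (K i), Matrix.mul_assoc X, this]
    simp only [Matrix.mul_assoc]

/-! ### Existence of a nonscalar Hermitian fixed point of the dual -/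

lemma exists_dual_fixed {n : ℕ} (hn : 1 ≤ n) (E : MatC n →ₗ[ℂ] MatC n) (h : IsQuantumChannel E)
    (hne : ¬ IsErgodic E) :
    ∃ Z : MatC n, (∀ X, (Z * E X).trace = (Z * X).trace) ∧ ¬ ∃ c : ℂ, Z = c • 1 := by
  by_contra hcon
  push Not at hcon
  apply hne
  have hr : LinearMap.range (E - 1) = LinearMap.ker (Matrix.traceLinearMap (Fin n) ℂ ℂ) := by
    apply le_antisymm
    · rintro _ ⟨X, rfl⟩
      simp [h.2]
    · intro Y hY
      by_contra hnot
      obtain ⟨φ, hφY, hφ⟩ := Submodule.exists_le_ker_of_notMem hnot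
      let Z : MatC n := Matrix.of fun i j => φ (Matrix.single j i 1)
      have hZ : ∀ X, φ X = (Z * X).trace := by
        intro X
        have : φ = (Matrix.traceLinearMap (Fin n) ℂ ℂ) ∘ₗ LinearMap.mulLeft ℂ Z := by
          apply Matrix.ext_linearMap
          intro i j
          ext1
          simp [Matrix.trace_mul_single, Z]
        rw [this]; rfl
      obtain ⟨c, hc⟩ := hcon Z (fun X => by
        have : φ ((E - 1) X) = 0 := hφ ⟨X, rfl⟩
        rw [LinearMap.sub_apply, map_sub, Module.End.one_apply, hZ, hZ] at this
        exact sub_eq_zero.1 this)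
      apply hφY
      have hY' : Y.trace = 0 := hY
      rw [hZ, hc]
      simp [hY']
  have h1 := LinearMap.finrank_range_add_finrank_ker (E - 1)
  have h2 := LinearMap.finrank_range_add_finrank_ker (Matrix.traceLinearMap (Fin n) ℂ ℂ)
  have h3 : LinearMap.range (Matrix.traceLinearMap (Fin n) ℂ ℂ) = ⊤ := by
    rw [LinearMap.range_eq_top]
    intro c
    exact ⟨Matrix.single ⟨0, hn⟩ ⟨0, hn⟩ c, by simp⟩
  rw [h3, finrank_top, Module.finrank_self] at h2
  rw [hr] at h1
  have h4 : Module.End.eigenspace E 1 = LinearMap.ker (E - 1) := by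
    rw [Module.End.eigenspace_def]; simp
  rw [IsErgodic, h4]
  exact Nat.add_left_cancel ((h1.trans h2.symm).trans (Nat.add_comm _ _))

lemma dual_star {n : ℕ} (E : MatC n →ₗ[ℂ] MatC n) (h : IsQuantumChannel E) {Z : MatC n}
    (hZ : ∀ X, (Z * E X).trace = (Z * X).trace) (X : MatC n) :
    (Zᴴ * E X).trace = (Zᴴ * X).trace := by
  obtain ⟨K, hK⟩ := exists_kraus E h.1
  have hE : E Xᴴ = (E X)ᴴ := by
    rw [hK, hK, conjTranspose_sum]
    refine Finset.sum_congr rfl fun i _ => ?_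
    simp [Matrix.mul_assoc]
  have := hZ Xᴴ
  rw [hE] at this
  have := congrArg star this
  rw [← Matrix.trace_conjTranspose, ← Matrix.trace_conjTranspose] at this
  simp only [conjTranspose_mul, conjTranspose_conjTranspose] at this
  rw [Matrix.trace_mul_comm, this, Matrix.trace_mul_comm]

lemma exists_herm_dual_fixed {n : ℕ} (hn : 1 ≤ n) (E : MatC n →ₗ[ℂ] MatC n)
    (h : IsQuantumChannel E) (hne : ¬ IsErgodic E) :
    ∃ Z : MatC n, Z.IsHermitian ∧ (∀ X, (Z * E X).trace = (Z * X).trace) ∧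
      ¬ ∃ c : ℂ, Z = c • 1 := by
  obtain ⟨Z, hZ, hns⟩ := exists_dual_fixed hn E h hne
  have hZs := dual_star E h hZ
  by_cases h1 : ∃ c : ℂ, Z + Zᴴ = c • 1
  · refine ⟨Complex.I • (Z - Zᴴ), ?_, ?_, ?_⟩
    · unfold Matrix.IsHermitian
      simp [conjTranspose_smul]
      module
    · intro X
      simp only [Matrix.smul_mul, Matrix.sub_mul, Matrix.trace_smul, Matrix.trace_sub, hZ, hZs]
    · rintro ⟨d, hd⟩
      obtain ⟨c, hc⟩ := h1
      apply hns
      refine ⟨(c - Complex.I * d) / 2, ?_⟩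
      have h2 : Z - Zᴴ = (-Complex.I * d) • (1 : MatC n) := by
        rw [mul_smul, ← hd, smul_smul]; simp
      have h3 : Z = (1 / 2 : ℂ) • ((Z + Zᴴ) + (Z - Zᴴ)) := by module
      rw [h3, hc, h2]
      module
  · refine ⟨Z + Zᴴ, ?_, ?_, h1⟩
    · unfold Matrix.IsHermitian
      simp [add_comm]
    · intro X
      simp only [Matrix.add_mul, Matrix.trace_add, hZ, hZs]

/-! ### Bipartite part -/

lemma block_left {d₁ d₂ : ℕ} (P : MatC d₂ →ₗ[ℂ] MatC d₂) (H₁ : MatC d₁) (H₂ : MatC d₂)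
    (hP : ∀ Y, P (H₂ * P Y) = H₂ * P Y) (M : MatC2 d₁ d₂) :
    idTensor P ((H₁ ⊗ₖ H₂) * idTensor P M) = (H₁ ⊗ₖ H₂) * idTensor P M := by
  have key : ∀ i j : Fin d₁,
      (Matrix.of fun a b => ((H₁ ⊗ₖ H₂) * idTensor P M) (i, a) (j, b) : MatC d₂) =
        ∑ k, H₁ i k • (H₂ * P (Matrix.of fun a b => M (k, a) (j, b))) := by
    intro i j
    ext a b
    simp [Matrix.mul_apply, Fintype.sum_prod_type, idTensor, Matrix.sum_apply, Finset.mul_sum,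
      mul_assoc]
  ext ⟨i, a⟩ ⟨j, b⟩
  have h1 : idTensor P ((H₁ ⊗ₖ H₂) * idTensor P M) (i, a) (j, b) =
    P (Matrix.of fun a b => ((H₁ ⊗ₖ H₂) * idTensor P M) (i, a) (j, b)) a b := rfl
  have h2 : ((H₁ ⊗ₖ H₂) * idTensor P M) (i, a) (j, b) =
    (Matrix.of fun a b => ((H₁ ⊗ₖ H₂) * idTensor P M) (i, a) (j, b) : MatC d₂) a b := rfl
  rw [h1, h2, key, map_sum]
  simp only [map_smul, hP]

lemma block_right {d₁ d₂ : ℕ} (P : MatC d₂ →ₗ[ℂ] MatC d₂) (H₁ : MatC d₁) (H₂ : MatC d₂)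
    (hP : ∀ Y, P (P Y * H₂) = P Y * H₂) (M : MatC2 d₁ d₂) :
    idTensor P (idTensor P M * (H₁ ⊗ₖ H₂)) = idTensor P M * (H₁ ⊗ₖ H₂) := by
  have key : ∀ i j : Fin d₁,
      (Matrix.of fun a b => (idTensor P M * (H₁ ⊗ₖ H₂)) (i, a) (j, b) : MatC d₂) =
        ∑ k, H₁ k j • (P (Matrix.of fun a b => M (i, a) (k, b)) * H₂) := by
    intro i j
    ext a b
    simp [Matrix.mul_apply, Fintype.sum_prod_type, idTensor, Matrix.sum_apply, Finset.mul_sum,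
      mul_left_comm]
  ext ⟨i, a⟩ ⟨j, b⟩
  have h1 : idTensor P (idTensor P M * (H₁ ⊗ₖ H₂)) (i, a) (j, b) =
    P (Matrix.of fun a b => (idTensor P M * (H₁ ⊗ₖ H₂)) (i, a) (j, b)) a b := rfl
  have h2 : (idTensor P M * (H₁ ⊗ₖ H₂)) (i, a) (j, b) =
    (Matrix.of fun a b => (idTensor P M * (H₁ ⊗ₖ H₂)) (i, a) (j, b) : MatC d₂) a b := rfl
  rw [h1, h2, key, map_sum]
  simp only [map_smul, hP]

lemma idTensor_sum {d₁ d₂ : ℕ} (S : Finset ℂ) (P : ℂ → (MatC d₂ →ₗ[ℂ] MatC d₂))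
    (M : MatC2 d₁ d₂) : idTensor (∑ μ ∈ S, P μ) M = ∑ μ ∈ S, idTensor (P μ) M := by
  ext p q
  simp [idTensor, Matrix.sum_apply]


lemma mem_maxGen {n : ℕ} (E : MatC n →ₗ[ℂ] MatC n) {μ : ℂ} {Y : MatC n} (hY : E Y = μ • Y) :
    Y ∈ Module.End.maxGenEigenspace E μ := by
  rw [Module.End.mem_maxGenEigenspace]
  exact ⟨1, by simp [hY]⟩

/-- **A non-ergodic bath channel fails to decouple.**
If the quantum channel `𝓔₂` is not ergodic, then there is a Hermitian bath operator `H₂`,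
whose left multiplication does not act as a scalar on the space of recurrences `X(𝓔₂)`,
that commutes with every peripheral spectral projection `P_ℓ` on `X(𝓔₂)` (for the left
action, the right action and the adjoint action).  Consequently, for every Hermitian
`H₁`, the coupling Hamiltonian `H = H₁ ⊗ H₂` satisfies
`(𝓘₁⊗P_ℓ) ∘ [H,·] ∘ (𝓘₁⊗P_ℓ) = [H,·] ∘ (𝓘₁⊗P_ℓ)` for every `ℓ`, so the Zeno Hamiltonian
equals `[H,·] ∘ (𝓘₁⊗P_φ)`: the interaction `H₁ ⊗ H₂` survives the Zeno projection. -/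
theorem non_ergodic_interaction_survives {d₁ d₂ : ℕ} (hd₁ : 2 ≤ d₁) (hd₂ : 1 ≤ d₂)
    (E₂ : MatC d₂ →ₗ[ℂ] MatC d₂) (hE₂ : IsQuantumChannel E₂) (hnotErg : ¬ IsErgodic E₂)
    (S : Finset ℂ) (hS : ∀ μ : ℂ, μ ∈ S ↔ (Module.End.HasEigenvalue E₂ μ ∧ ‖μ‖ = 1))
    (P : ℂ → (MatC d₂ →ₗ[ℂ] MatC d₂)) (hP : ∀ μ ∈ S, IsSpectralProjection E₂ (P μ) μ) :
    ∃ H₂ : MatC d₂, H₂.IsHermitian ∧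
      ¬ (∃ c : ℂ, ∀ X ∈ recSpace E₂, H₂ * X = c • X) ∧
      (∀ μ ∈ S, ∀ X ∈ recSpace E₂,
        H₂ * P μ X = P μ (H₂ * X) ∧
        P μ X * H₂ = P μ (X * H₂) ∧
        H₂ * P μ X - P μ X * H₂ = P μ (H₂ * X - X * H₂)) ∧
      (∀ H₁ : MatC d₁, H₁.IsHermitian →
        (∀ μ ∈ S, ∀ M : MatC2 d₁ d₂,
          idTensor (P μ) ((H₁ ⊗ₖ H₂) * idTensor (P μ) M - idTensor (P μ) M * (H₁ ⊗ₖ H₂))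
            = (H₁ ⊗ₖ H₂) * idTensor (P μ) M - idTensor (P μ) M * (H₁ ⊗ₖ H₂)) ∧
        (∀ M : MatC2 d₁ d₂,
          ∑ μ ∈ S, idTensor (P μ)
              ((H₁ ⊗ₖ H₂) * idTensor (P μ) M - idTensor (P μ) M * (H₁ ⊗ₖ H₂))
            = (H₁ ⊗ₖ H₂) * idTensor (∑ μ ∈ S, P μ) M
              - idTensor (∑ μ ∈ S, P μ) M * (H₁ ⊗ₖ H₂))) := by
  obtain ⟨Z, hZ, hZE, hns⟩ := exists_herm_dual_fixed hd₂ E₂ hE₂ hnotErg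
  have hfix : ∀ μ ∈ S, ∀ Y, E₂ Y = μ • Y → P μ Y = Y := by
    intro μ hμ Y hY
    obtain ⟨hpp, hran, -⟩ := hP μ hμ
    have hm : Y ∈ LinearMap.range (P μ) := by
      rw [hran]
      exact mem_maxGen E₂ hY
    obtain ⟨W, rfl⟩ := hm
    exact LinearMap.congr_fun hpp W
  have hkill : ∀ μ ∈ S, ∀ ν, ν ≠ μ → ∀ Y, E₂ Y = ν • Y → P μ Y = 0 := by
    intro μ hμ ν hν Y hY
    obtain ⟨-, -, hker⟩ := hP μ hμ
    have hm : Y ∈ LinearMap.ker (P μ) := by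
      rw [hker]
      refine Submodule.mem_iSup_of_mem ν (Submodule.mem_iSup_of_mem hν ?_)
      exact mem_maxGen E₂ hY
    exact hm
  have hnorm : ∀ μ ∈ S, ‖μ‖ = 1 := fun μ hμ => ((hS μ).1 hμ).2
  have hran : ∀ μ ∈ S, ∀ Y, E₂ (P μ Y) = μ • P μ Y := by
    intro μ hμ Y
    refine maxGen_eq E₂ hE₂ (hnorm μ hμ) ?_
    rw [← (hP μ hμ).2.1]
    exact ⟨Y, rfl⟩
  have hPl : ∀ μ ∈ S, ∀ Y, P μ (Z * P μ Y) = Z * P μ Y := fun μ hμ Y =>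
    hfix μ hμ _ (mul_intertwine E₂ hE₂ hZ hZE (hnorm μ hμ) (hran μ hμ Y)).1
  have hPr : ∀ μ ∈ S, ∀ Y, P μ (P μ Y * Z) = P μ Y * Z := fun μ hμ Y =>
    hfix μ hμ _ (mul_intertwine E₂ hE₂ hZ hZE (hnorm μ hμ) (hran μ hμ Y)).2
  have hboth : ∀ μ ∈ S, ∀ X ∈ recSpace E₂,
      Z * P μ X = P μ (Z * X) ∧ P μ X * Z = P μ (X * Z) := by
    intro μ hμ X hX
    have hle : recSpace E₂ ≤
        LinearMap.ker (LinearMap.mulLeft ℂ Z ∘ₗ P μ - P μ ∘ₗ LinearMap.mulLeft ℂ Z) ⊓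
        LinearMap.ker (LinearMap.mulRight ℂ Z ∘ₗ P μ - P μ ∘ₗ LinearMap.mulRight ℂ Z) := by
      refine iSup₂_le fun ν hν Y hY => ?_
      have hY' := Module.End.mem_eigenspace_iff.1 hY
      obtain ⟨hl, hr⟩ := mul_intertwine E₂ hE₂ hZ hZE hν hY'
      by_cases hνμ : ν = μ
      · subst hνμ
        simp [hfix ν hμ _ hY', hfix ν hμ _ hl, hfix ν hμ _ hr]
      · simp [hkill μ hμ ν hνμ _ hY', hkill μ hμ ν hνμ _ hl, hkill μ hμ ν hνμ _ hr]
    have h2 := hle hX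
    simp only [Submodule.mem_inf, LinearMap.mem_ker, LinearMap.sub_apply, LinearMap.comp_apply,
      LinearMap.mulLeft_apply, LinearMap.mulRight_apply, sub_eq_zero] at h2
    exact h2
  have hone : ∀ H₁ : MatC d₁, ∀ μ ∈ S, ∀ M : MatC2 d₁ d₂,
      idTensor (P μ) ((H₁ ⊗ₖ Z) * idTensor (P μ) M - idTensor (P μ) M * (H₁ ⊗ₖ Z))
        = (H₁ ⊗ₖ Z) * idTensor (P μ) M - idTensor (P μ) M * (H₁ ⊗ₖ Z) := by
    intro H₁ μ hμ M
    rw [map_sub, block_left _ _ _ (hPl μ hμ), block_right _ _ _ (hPr μ hμ)]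
  refine ⟨Z, hZ, ?_, ?_, ?_⟩
  · rintro ⟨c, hc⟩
    apply hns
    refine ⟨c, Matrix.ext_iff_trace_mul_right.2 fun X => ?_⟩
    obtain ⟨f, g, hf, rfl⟩ := exists_decomp E₂ hE₂ X
    have hfr : f ∈ recSpace E₂ := by
      refine Submodule.mem_iSup_of_mem 1 (Submodule.mem_iSup_of_mem (by simp) ?_)
      exact Module.End.mem_eigenspace_iff.2 (by simpa using hf)
    rw [Matrix.mul_add, Matrix.mul_sub, hc f hfr]
    simp [Matrix.mul_add, Matrix.mul_sub, hZE, hE₂.2]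
  · intro μ hμ X hX
    obtain ⟨h1, h2⟩ := hboth μ hμ X hX
    exact ⟨h1, h2, by rw [map_sub, h1, h2]⟩
  · intro H₁ _
    refine ⟨hone H₁, fun M => ?_⟩
    rw [Finset.sum_congr rfl fun μ hμ => hone H₁ μ hμ M, idTensor_sum, Finset.sum_sub_distrib,
      Finset.mul_sum, Finset.sum_mul]
end
end
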